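/- There is an absolute constant c > 0 such that the following holds for all natural numbers s, w, s', w': if every nondeterministic circuit of size at most s + ⌈w/2⌉ and width at most w can be converted to a deterministic circuit of size at most s' and width at most w' computing the same Boolean function, then every nondeterministic circuit of size at most 2s and width at most w can be converted to a deterministic circuit of size at most c · 2^w · s' and width at most w' + 2 computing the same Boolean function. -/

import Mathlib

/-!
Common definitions: Boolean circuits (with AND/OR/NOT gates of fan-in ≤ 2 and
dummy COPY gates used only for layering), nondeterministic circuits with guess
inputs, width via layerings, nondeterministic branching programs, and
U₂-circuits with their deterministic/nondeterministic circuit complexities.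
-/

/-- A node of a circuit with `n` actual inputs and `m` guess inputs.
Gate nodes refer to their predecessors by (strictly smaller) indices. -/
inductive CNode (n m : ℕ) : Type where
  | actual : Fin n → CNode n m
  | guess  : Fin m → CNode n m
  | const  : Bool → CNode n m
  | gand   : ℕ → ℕ → CNode n m
  | gor    : ℕ → ℕ → CNode n m
  | gnot   : ℕ → CNode n m
  | gcopy  : ℕ → CNode n m
deriving DecidableEq

namespace CNode

/-- The predecessor indices of a node. -/
def preds {n m : ℕ} : CNode n m → List ℕ
  | gand j k => [j, k]
  | gor j k  => [j, k]
  | gnot j   => [j]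
  | gcopy j  => [j]
  | _        => []

/-- Real gates (AND, OR, NOT); these are the gates counted in the size.
COPY gates are dummy gates inserted only to make the circuit layered. -/
def isGate {n m : ℕ} : CNode n m → Bool
  | gand _ _ => true
  | gor _ _  => true
  | gnot _   => true
  | _        => false

/-- Nodes occupying space in a layer (real gates and COPY gates);
these are counted in the width of a layer. -/
def isWide {n m : ℕ} : CNode n m → Bool
  | gand _ _ => true
  | gor _ _  => true
  | gnot _   => true
  | gcopy _  => true
  | _        => false

end CNode

/-- A (nondeterministic) Boolean circuit with `n` actual inputs and `m` guess
inputs: a DAG whose in-degree-0 nodes are labeled by actual inputs, guess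
inputs or constants, whose gates are AND/OR/NOT gates (plus dummy COPY gates),
with a designated output node.  Each guess input labels at most one node. -/
structure Circuit (n m : ℕ) : Type where
  N : ℕ
  node : Fin N → CNode n m
  output : Fin N
  wf : ∀ i : Fin N, ∀ j ∈ (node i).preds, j < (i : ℕ)
  guessOnce : ∀ g : Fin m,
    (Finset.univ.filter (fun i : Fin N => node i = CNode.guess g)).card ≤ 1

namespace Circuit

variable {n m : ℕ}

def nodeAt (c : Circuit n m) (i : ℕ) : CNode n m :=
  if h : i < c.N then c.node ⟨i, h⟩ else CNode.const false

/-- The Boolean value computed at node `i` on actual inputs `x` and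
guess inputs `y`. -/
def evalAux (c : Circuit n m) (x : Fin n → Bool) (y : Fin m → Bool) : ℕ → Bool
  | i =>
    match c.nodeAt i with
    | CNode.actual a => x a
    | CNode.guess g => y g
    | CNode.const b => b
    | CNode.gand j k =>
        (if _h : j < i then c.evalAux x y j else false) &&
        (if _h : k < i then c.evalAux x y k else false)
    | CNode.gor j k =>
        (if _h : j < i then c.evalAux x y j else false) ||
        (if _h : k < i then c.evalAux x y k else false)
    | CNode.gnot j => !(if _h : j < i then c.evalAux x y j else false)
    | CNode.gcopy j => (if _h : j < i then c.evalAux x y j else false)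
termination_by i => i

/-- The output value of the circuit. -/
def eval (c : Circuit n m) (x : Fin n → Bool) (y : Fin m → Bool) : Bool :=
  c.evalAux x y c.output

/-- A nondeterministic circuit computes `f` if for every actual input `x`,
`f x = 1` iff some assignment of the guess inputs makes the circuit output 1.
(For `m = 0` this is the usual notion for deterministic circuits.) -/
def Computes (c : Circuit n m) (f : (Fin n → Bool) → Bool) : Prop :=
  ∀ x : Fin n → Bool, f x = true ↔ ∃ y : Fin m → Bool, c.eval x y = true

/-- The size of a circuit: the number of (non-COPY) gates. -/
def size (c : Circuit n m) : ℕ :=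
  (Finset.univ.filter (fun i : Fin c.N => (c.node i).isGate = true)).card

/-- `ℓ` is a layering of the circuit: every wire goes between adjacent layers. -/
def IsLayering (c : Circuit n m) (ℓ : Fin c.N → ℕ) : Prop :=
  ∀ i : Fin c.N, ∀ j ∈ (c.node i).preds, ∀ hj : j < c.N, ℓ ⟨j, hj⟩ + 1 = ℓ i

/-- The circuit has width at most `w`: there is a layering in which every layer
contains at most `w` gates (real gates and COPY gates). -/
def HasWidth (c : Circuit n m) (w : ℕ) : Prop :=
  ∃ ℓ : Fin c.N → ℕ, c.IsLayering ℓ ∧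
    ∀ t : ℕ,
      (Finset.univ.filter
        (fun i : Fin c.N => ℓ i = t ∧ (c.node i).isWide = true)).card ≤ w

/-- The circuit is read-`k`-times: every actual input labels at most `k` nodes. -/
def ReadK (c : Circuit n m) (k : ℕ) : Prop :=
  ∀ a : Fin n,
    (Finset.univ.filter (fun i : Fin c.N => c.node i = CNode.actual a)).card ≤ k

/-- The maximal number of (non-COPY) gates on a path ending at node `i`. -/
def depthAux (c : Circuit n m) : ℕ → ℕ
  | i =>
    match c.nodeAt i with
    | CNode.actual _ => 0
    | CNode.guess _ => 0
    | CNode.const _ => 0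
    | CNode.gand j k =>
        max (if _h : j < i then c.depthAux j else 0)
            (if _h : k < i then c.depthAux k else 0) + 1
    | CNode.gor j k =>
        max (if _h : j < i then c.depthAux j else 0)
            (if _h : k < i then c.depthAux k else 0) + 1
    | CNode.gnot j => (if _h : j < i then c.depthAux j else 0) + 1
    | CNode.gcopy j => (if _h : j < i then c.depthAux j else 0)
termination_by i => i

/-- The depth of a circuit: the maximal number of gates on a directed path
from an input to the output. -/
def depth (c : Circuit n m) : ℕ := c.depthAux c.output

end Circuit

/-- A nondeterministic branching program on `n` Boolean variables: a DAG whose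
inner nodes are labeled by variables with outgoing edges labeled 0 or 1 (edges
go to strictly larger indices), whose sinks are labeled 0 or 1, with a
designated start node. -/
structure NBP (n : ℕ) : Type where
  N : ℕ
  label : Fin N → Fin n ⊕ Bool
  edges : Fin N → Bool → Finset (Fin N)
  start : Fin N
  wf : ∀ i : Fin N, ∀ b : Bool, ∀ j ∈ edges i b,
        (i : ℕ) < (j : ℕ) ∧ (label i).isLeft

namespace NBP

variable {n : ℕ}

/-- The size of a branching program: the number of its nodes. -/
def size (B : NBP n) : ℕ := B.N

/-- On input `x`, some path from node `i` consistent with `x` reaches a 1-sink. -/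
def AccFrom (B : NBP n) (x : Fin n → Bool) : Fin B.N → Prop
  | i =>
    match B.label i with
    | Sum.inr b => b = true
    | Sum.inl v => ∃ j ∈ B.edges i (x v), ∃ _h : (i : ℕ) < (j : ℕ), B.AccFrom x j
termination_by i => B.N - (i : ℕ)
decreasing_by
  have := j.isLt
  omega

/-- A nondeterministic branching program computes `f` if for every `x`,
`f x = 1` iff at least one path consistent with `x` leads to a 1-sink. -/
def Computes (B : NBP n) (f : (Fin n → Bool) → Bool) : Prop :=
  ∀ x : Fin n → Bool, f x = true ↔ B.AccFrom x B.start

/-- A (syntactic) path in the underlying graph of the branching program. -/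
def IsPath (B : NBP n) : List (Fin B.N) → Prop
  | [] => True
  | [_] => True
  | i :: j :: p => (∃ b : Bool, j ∈ B.edges i b) ∧ B.IsPath (j :: p)

/-- The branching program is syntactic read-`k`-times: every variable appears
at most `k` times on each path. -/
def SyntacticReadK (B : NBP n) (k : ℕ) : Prop :=
  ∀ p : List (Fin B.N), B.IsPath p → ∀ v : Fin n,
    (p.countP fun i => decide (B.label i = Sum.inl v)) ≤ k

end NBP

/-- A node of a `U₂`-circuit.  A gate `gate a b c j k` computes
`((vⱼ ⊕ a) ∧ (v_k ⊕ b)) ⊕ c` from the values `vⱼ, v_k` of its two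
predecessors; these are exactly the Boolean functions in `U₂`
(all two-variable Boolean functions except XOR and its complement). -/
inductive U2Node (n m : ℕ) : Type where
  | actual : Fin n → U2Node n m
  | guess  : Fin m → U2Node n m
  | const  : Bool → U2Node n m
  | gate   : Bool → Bool → Bool → ℕ → ℕ → U2Node n m
deriving DecidableEq

namespace U2Node

def isGate {n m : ℕ} : U2Node n m → Bool
  | gate _ _ _ _ _ => true
  | _ => false

end U2Node

/-- A (nondeterministic) `U₂`-circuit with `n` actual inputs and `m` guess
inputs: every gate has fan-in 2 and is labeled by a function in `U₂`. -/
structure U2Circuit (n m : ℕ) : Type where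
  N : ℕ
  node : Fin N → U2Node n m
  output : Fin N
  wf : ∀ i : Fin N, ∀ a b c j k,
        node i = U2Node.gate a b c j k → j < (i : ℕ) ∧ k < (i : ℕ)

namespace U2Circuit

variable {n m : ℕ}

def nodeAt (c : U2Circuit n m) (i : ℕ) : U2Node n m :=
  if h : i < c.N then c.node ⟨i, h⟩ else U2Node.const false

def evalAux (c : U2Circuit n m) (x : Fin n → Bool) (y : Fin m → Bool) : ℕ → Bool
  | i =>
    match c.nodeAt i with
    | U2Node.actual a => x a
    | U2Node.guess g => y g
    | U2Node.const b => b
    | U2Node.gate a b cc j k =>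
        xor
          ((xor (if _h : j < i then c.evalAux x y j else false) a) &&
           (xor (if _h : k < i then c.evalAux x y k else false) b))
          cc
termination_by i => i

def eval (c : U2Circuit n m) (x : Fin n → Bool) (y : Fin m → Bool) : Bool :=
  c.evalAux x y c.output

/-- A nondeterministic `U₂`-circuit computes `f` if for every actual input `x`,
`f x = 1` iff some assignment of the guess inputs makes the circuit output 1. -/
def Computes (c : U2Circuit n m) (f : (Fin n → Bool) → Bool) : Prop :=
  ∀ x : Fin n → Bool, f x = true ↔ ∃ y : Fin m → Bool, c.eval x y = true

/-- The size of a `U₂`-circuit: the number of its gates. -/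
def size (c : U2Circuit n m) : ℕ :=
  (Finset.univ.filter (fun i : Fin c.N => (c.node i).isGate = true)).card

end U2Circuit

/-- `size^dc f`: the size of the smallest deterministic `U₂`-circuit
computing `f`. -/
noncomputable def sizeDC {n : ℕ} (f : (Fin n → Bool) → Bool) : ℕ :=
  sInf {s : ℕ | ∃ c : U2Circuit n 0, c.Computes f ∧ c.size = s}

/-- `size^ndc f`: the size of the smallest nondeterministic `U₂`-circuit
computing `f`. -/
noncomputable def sizeNDC {n : ℕ} (f : (Fin n → Bool) → Bool) : ℕ :=
  sInf {s : ℕ | ∃ m : ℕ, ∃ c : U2Circuit n m, c.Computes f ∧ c.size = s}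

/-- The parity function: `parityFun n x = 1` iff `Σ xᵢ ≡ 1 (mod 2)`. -/
def parityFun (n : ℕ) : (Fin n → Bool) → Bool :=
  fun x => decide ((∑ i : Fin n, (x i).toNat) % 2 = 1)

theorem blockIdx_lt {m : ℕ} (i j : Fin m) : m * (i : ℕ) + (j : ℕ) < m * m := by
  have hi := i.isLt
  have hj := j.isLt
  nlinarith

/-- The disjunction of the parities of the `m` consecutive blocks of `m`
variables:
`⋁_{i=0}^{m-1} Parity_m (x_{m·i+1}, …, x_{m·i+m})` on `n = m²` variables. -/
def blockParityOr (m : ℕ) : (Fin (m * m) → Bool) → Bool :=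
  fun x => decide (∃ i : Fin m,
    parityFun m (fun j => x ⟨m * (i : ℕ) + (j : ℕ), blockIdx_lt i j⟩) = true)

/-- A gate of a layer as a function of fresh guesses in `V` and remaining data in `Z`: either it
ignores the guesses, or it is the constant `c` as soon as one of its guesses takes its absorbing
value. -/
inductive LayerGate (Z V : Type*) where
  | fixed (h : Z → Bool)
  | one (v : V) (β c : Bool) (h : Z → Bool)
  | two (v v' : V) (β β' c : Bool)

namespace LayerGate

variable {Z V ι : Type*}

/-- The value of a layer gate. -/
def eval : LayerGate Z V → Z → (V → Bool) → Bool
  | fixed h, z, _ => h z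
  | one v β c h, z, y => if y v = β then c else h z
  | two v v' β β' c, _, y => if y v = β ∨ y v' = β' then c else !c

/-- The number of occurrences of guesses. -/
def occ : LayerGate Z V → ℕ
  | fixed _ => 0
  | one _ _ _ _ => 1
  | two _ _ _ _ _ => 2

/-- Substitute the value `a` for the guess `v`. -/
def subst [DecidableEq V] (v : V) (a : Bool) : LayerGate Z V → LayerGate Z V
  | fixed h => fixed h
  | one u β c h =>
    if u = v then (if a = β then fixed fun _ => c else fixed h) else one u β c h
  | two u u' β β' c =>
    if u = v then
      if a = β then fixed fun _ => c
      else if u' = v then (if a = β' then fixed fun _ => c else fixed fun _ => !c)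
      else one u' β' c fun _ => !c
    else if u' = v then (if a = β' then fixed fun _ => c else one u β c fun _ => !c)
    else two u u' β β' c

/-- Gates that are determined by at most one guess alone. -/
inductive Simple : LayerGate Z V → Prop
  | fixed (h : Z → Bool) : Simple (fixed h)
  | one (v : V) (β c : Bool) : Simple (one v β c fun _ => !c)

theorem eval_of_occ_eq_zero {g : LayerGate Z V} (hg : g.occ = 0) (z : Z) (y y' : V → Bool) :
    g.eval z y = g.eval z y' := by
  cases g <;> simp_all [occ, eval]

section Subst

variable [DecidableEq V]

theorem eval_subst (g : LayerGate Z V) (v : V) (a : Bool) (z : Z) (y : V → Bool) :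
    (g.subst v a).eval z y = g.eval z (Function.update y v a) := by
  cases g <;> simp only [subst] <;> (try split_ifs) <;> simp_all [eval]

theorem occ_subst_le (g : LayerGate Z V) (v : V) (a : Bool) : (g.subst v a).occ ≤ g.occ := by
  cases g <;> simp only [subst] <;> (try split_ifs) <;> simp [occ]

theorem Simple.subst {g : LayerGate Z V} (hg : g.Simple) (v : V) (a : Bool) :
    (g.subst v a).Simple := by
  cases hg <;> simp only [LayerGate.subst] <;> (try split_ifs) <;> constructor

theorem simple_subst_not {g : LayerGate Z V} {v : V} {β c : Bool}
    (h : g.subst v β = fixed fun _ => c) : (g.subst v !β).Simple := by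
  cases g <;> simp only [LayerGate.subst] at h ⊢ <;> (try split_ifs at h ⊢) <;> constructor

theorem exists_absorbing {g : LayerGate Z V} (hg : g.occ ≠ 0) :
    ∃ v β c, g.subst v β = (fixed fun _ => c) ∧ ∀ a, (g.subst v a).occ < g.occ := by
  cases g with
  | fixed h => simp [occ] at hg
  | one v β c h =>
    exact ⟨v, β, c, by simp [subst], fun a => by simp only [subst]; split_ifs <;> simp_all [occ]⟩
  | two v v' β β' c =>
    exact ⟨v, β, c, by simp [subst], fun a => by simp only [subst]; split_ifs <;> simp_all [occ]⟩

theorem eval_update_of_not_absorbing {g : LayerGate Z V} {v : V}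
    (h : ∀ β c, g.subst v β ≠ fixed fun _ => c) (z : Z) (y : V → Bool) (a : Bool) :
    g.eval z (Function.update y v a) = g.eval z y := by
  rw [← eval_subst]
  have hs : g.subst v a = g := by
    cases g with
    | fixed => rfl
    | one u β c k =>
      have := h β c
      simp only [subst] at this ⊢
      split_ifs at this ⊢ <;> simp_all
    | two u u' β β' c =>
      have h1 := h β c
      have h2 := h β' c
      simp only [subst] at h1 h2 ⊢
      split_ifs at h1 h2 ⊢ <;> simp_all
  rw [hs]

theorem Simple.decide {g : LayerGate Z V} (hg : g.Simple) (a : Bool) :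
    g.occ = 0 ∨ ∃ v e, g.subst v e = (LayerGate.fixed fun _ => a) ∧
      ∀ z y, g.eval z y = a → y v = e := by
  cases hg with
  | fixed h => exact Or.inl rfl
  | one v β c =>
    refine Or.inr ⟨v, if a = c then β else !β, ?_, fun z y => ?_⟩
    · cases a <;> cases c <;> cases β <;> simp [LayerGate.subst]
    · cases a <;> cases c <;> cases β <;> simp [eval]

theorem sum_occ_subst_le [Fintype ι] (gs : ι → LayerGate Z V) (v : V) (a : Bool) :
    ∑ g, ((gs g).subst v a).occ ≤ ∑ g, (gs g).occ :=
  Finset.sum_le_sum fun _ _ => occ_subst_le _ _ _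

end Subst

/-- `k` pairs of an output vector and a guess vector suffice for producing all outputs of the
gates on the region `R`. -/
def Cov (gs : ι → LayerGate Z V) (R : Z → (V → Bool) → Prop) (k : ℕ) : Prop :=
  ∃ O : Finset ((ι → Bool) × (V → Bool)), O.card ≤ k ∧ ∀ z y, R z y →
    ∃ o ∈ O, ∀ g, (gs g).eval z y = o.1 g ∧ (gs g).eval z o.2 = o.1 g

/-- The gates outside of `S` output `b`. -/
def Agree (gs : ι → LayerGate Z V) (S : Finset ι) (b : ι → Bool) (z : Z) (y : V → Bool) : Prop :=
  ∀ g ∉ S, (gs g).eval z y = b g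

section Cov

variable {gs gs' : ι → LayerGate Z V} {R R' R₁ R₂ : Z → (V → Bool) → Prop} {k k' k₁ k₂ : ℕ}

theorem Cov.mono (h : Cov gs R k) (hk : k ≤ k') : Cov gs R k' := by
  obtain ⟨O, hO, h⟩ := h
  exact ⟨O, hO.trans hk, h⟩

variable [Fintype ι] [Fintype V]

theorem Cov.union (h₁ : Cov gs R₁ k₁) (h₂ : Cov gs R₂ k₂)
    (hR : ∀ z y, R z y → R₁ z y ∨ R₂ z y) : Cov gs R (k₁ + k₂) := by
  obtain ⟨O₁, hO₁, h₁⟩ := h₁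
  obtain ⟨O₂, hO₂, h₂⟩ := h₂
  refine ⟨O₁ ∪ O₂, (Finset.card_union_le _ _).trans (by omega), fun z y hz => ?_⟩
  rcases hR z y hz with hz | hz
  · obtain ⟨o, ho, h⟩ := h₁ z y hz
    exact ⟨o, Finset.mem_union_left _ ho, h⟩
  · obtain ⟨o, ho, h⟩ := h₂ z y hz
    exact ⟨o, Finset.mem_union_right _ ho, h⟩

theorem Cov.pullback (T : (V → Bool) → V → Bool)
    (hT : ∀ g z y, (gs' g).eval z y = (gs g).eval z (T y)) (h : Cov gs' R' k)
    (hR : ∀ z y, R z y → ∃ y', (∀ g, (gs g).eval z (T y') = (gs g).eval z y) ∧ R' z y') :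
    Cov gs R k := by
  obtain ⟨O, hO, h⟩ := h
  refine ⟨O.image fun o => (o.1, T o.2), Finset.card_image_le.trans hO, fun z y hz => ?_⟩
  obtain ⟨y', he, hy'⟩ := hR z y hz
  obtain ⟨o, ho, h⟩ := h z y' hy'
  refine ⟨_, Finset.mem_image_of_mem _ ho, fun g => ⟨?_, ?_⟩⟩
  · rw [← he, ← hT]
    exact (h g).1
  · rw [← hT]
    exact (h g).2

theorem cov_of_occ_eq_zero [DecidableEq ι] (h : ∀ g, (gs g).occ = 0) (S : Finset ι) (b : ι → Bool) :
    Cov gs (Agree gs S b) (2 ^ S.card) := by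
  refine ⟨S.powerset.image fun T => (fun g => if g ∈ S then decide (g ∈ T) else b g,
    fun _ => false), Finset.card_image_le.trans (Finset.card_powerset S).le, fun z y hz => ?_⟩
  refine ⟨_, Finset.mem_image_of_mem _
    (Finset.mem_powerset.2 (Finset.filter_subset (fun g => (gs g).eval z y = true) S)), fun g => ?_⟩
  rw [eval_of_occ_eq_zero (h g) z (fun _ => false) y, and_self]
  by_cases hg : g ∈ S
  · simp [hg]
  · simpa [hg] using hz g hg

variable [DecidableEq V]

theorem Cov.subst {v : V} {a : Bool} (h : Cov (fun g => (gs g).subst v a) R' k)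
    (hR : ∀ z y, R z y → ∃ y', y' v = a ∧ (∀ g, (gs g).eval z y' = (gs g).eval z y) ∧ R' z y') :
    Cov gs R k := by
  refine h.pullback (fun y => Function.update y v a) (fun g z y => eval_subst _ _ _ _ _) ?_
  intro z y hz
  obtain ⟨y', rfl, h1, h2⟩ := hR z y hz
  exact ⟨y', by simpa using h1, h2⟩

variable [DecidableEq ι]

/-- One can split off the cases where some gate in `D` differs from `c`. -/
theorem cov_of_simple (K : ℕ)
    (ih : ∀ (gs : ι → LayerGate Z V) (S : Finset ι) (b : ι → Bool), ∑ g, (gs g).occ ≤ K →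
      (∀ g ∉ S, (gs g).occ = 0) → Cov gs (Agree gs S b) (2 ^ S.card)) (c : ι → Bool)
    (D : Finset ι) : ∀ (gs : ι → LayerGate Z V) (S : Finset ι) (b : ι → Bool),
      ∑ g, (gs g).occ ≤ K → (∀ g ∉ S, (gs g).occ = 0) → D ⊆ S → (∀ g ∈ D, (gs g).Simple) →
      ∃ k, k + 2 ^ (S \ D).card ≤ 2 ^ S.card ∧
        Cov gs (fun z y => Agree gs S b z y ∧ ¬∀ g ∈ D, (gs g).eval z y = c g) k := by
  induction D using Finset.induction_on with
  | empty => exact fun gs S b _ _ _ _ => ⟨0, by simp, ∅, by simp, by simp⟩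
  | insert g D hgD hD =>
    intro gs S b hK hS hDS hs
    have hgS : g ∈ S := hDS (Finset.mem_insert_self _ _)
    have dec : ∀ a, ∃ gs' : ι → LayerGate Z V, ∑ g, (gs' g).occ ≤ K ∧
        (∀ g' ∉ S.erase g, (gs' g').occ = 0) ∧ (∀ g' ∈ D, (gs' g').Simple) ∧
        ∀ (k : ℕ) (X : (ι → Bool) → Prop),
          Cov gs' (fun z y => Agree gs' (S.erase g) (Function.update b g a) z y ∧
            X fun g' => (gs' g').eval z y) k →
          Cov gs (fun z y => Agree gs S b z y ∧ (gs g).eval z y = a ∧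
            X fun g' => (gs g').eval z y) k := by
      intro a
      have hag : ∀ z y, Agree gs S b z y → (gs g).eval z y = a →
          ∀ g' ∉ S.erase g, (gs g').eval z y = Function.update b g a g' := by
        intro z y h1 h2 g' hg'
        rcases eq_or_ne g' g with rfl | hne
        · simpa using h2
        · simpa [hne] using h1 g' fun h => hg' (Finset.mem_erase.2 ⟨hne, h⟩)
      rcases (hs g (Finset.mem_insert_self _ _)).decide a with h0 | ⟨v, e, hve, he⟩
      · refine ⟨gs, hK, fun g' hg' => ?_, fun g' hg' => hs g' (Finset.mem_insert_of_mem hg'),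
          fun k X h => h.pullback id (fun _ _ _ => rfl) fun z y hz =>
            ⟨y, fun _ => rfl, hag z y hz.1 hz.2.1, hz.2.2⟩⟩
        rcases eq_or_ne g' g with rfl | hne
        · exact h0
        · exact hS g' fun h => hg' (Finset.mem_erase.2 ⟨hne, h⟩)
      · refine ⟨fun g' => (gs g').subst v e, (sum_occ_subst_le _ _ _).trans hK, fun g' hg' => ?_,
          fun g' hg' => (hs g' (Finset.mem_insert_of_mem hg')).subst v e,
          fun k X h => h.subst fun z y hz => ?_⟩
        · rcases eq_or_ne g' g with rfl | hne
          · simp [hve, occ]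
          · exact Nat.le_zero.1 ((occ_subst_le _ v e).trans
              (hS g' fun h => hg' (Finset.mem_erase.2 ⟨hne, h⟩)).le)
        · obtain rfl := he z y hz.2.1
          refine ⟨y, rfl, fun _ => rfl, fun g' hg' => ?_, ?_⟩
          · simpa [eval_subst] using hag z y hz.1 hz.2.1 g' hg'
          · simpa [eval_subst] using hz.2.2
    obtain ⟨gs₁, k1, s1, -, t1⟩ := dec (!c g)
    obtain ⟨gs₂, k2, s2, m2, t2⟩ := dec (c g)
    have hsub : D ⊆ S.erase g := fun g' hg' => Finset.mem_erase.2
      ⟨fun h => hgD (h ▸ hg'), hDS (Finset.mem_insert_of_mem hg')⟩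
    have c1 := t1 _ (fun _ => True) (by simpa using ih gs₁ (S.erase g) _ k1 s1)
    obtain ⟨k, hk, c2⟩ := hD gs₂ (S.erase g) (Function.update b g (c g)) k2 s2 hsub m2
    have c2 := t2 k (fun b => ¬∀ g ∈ D, b g = c g) c2
    have hcard : 2 ^ S.card = 2 ^ (S.erase g).card + 2 ^ (S.erase g).card := by
      rw [← Finset.card_erase_add_one hgS, pow_succ]
      omega
    refine ⟨_, ?_, c1.union c2 ?_⟩
    · rw [Finset.sdiff_insert, ← Finset.erase_sdiff_comm]
      omega
    · intro z y hz
      by_cases hg : (gs g).eval z y = c g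
      · refine Or.inr ⟨hz.1, hg, fun hall => hz.2 fun g' hg' => ?_⟩
        rcases Finset.mem_insert.1 hg' with rfl | hg'
        · exact hg
        · exact hall g' hg'
      · exact Or.inl ⟨hz.1, by simpa using Bool.eq_not.2 hg, trivial⟩

theorem cov_agree (K : ℕ) : ∀ (gs : ι → LayerGate Z V) (S : Finset ι) (b : ι → Bool),
    ∑ g, (gs g).occ ≤ K → (∀ g ∉ S, (gs g).occ = 0) → Cov gs (Agree gs S b) (2 ^ S.card) := by
  induction K with
  | zero => exact fun gs S b hK _ => cov_of_occ_eq_zero (by simpa using hK) S b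
  | succ K ih =>
    intro gs S b hK hS
    by_cases h0 : ∀ g, (gs g).occ = 0
    · exact cov_of_occ_eq_zero h0 S b
    push Not at h0
    obtain ⟨g₀, hg₀⟩ := h0
    obtain ⟨v, β, c₀, hβ, hlt⟩ := exists_absorbing hg₀
    have hK' : ∀ a, ∑ g, ((gs g).subst v a).occ ≤ K := fun a => by
      have : ∑ g, ((gs g).subst v a).occ < ∑ g, (gs g).occ :=
        Finset.sum_lt_sum (fun _ _ => occ_subst_le _ _ _) ⟨g₀, Finset.mem_univ _, hlt a⟩
      omega
    have hS' : ∀ a, ∀ g ∉ S, ((gs g).subst v a).occ = 0 := fun a g hg => by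
      have := occ_subst_le (gs g) v a
      have := hS g hg
      omega
    classical
    let D : Bool → Finset ι := fun a => S.filter fun g => ∃ c, (gs g).subst v a = fixed fun _ => c
    have hg₀D : g₀ ∈ D β := Finset.mem_filter.2 ⟨by_contra fun h => hg₀ (hS g₀ h), c₀, hβ⟩
    choose! c hc using fun a g (hg : g ∈ D a) => (Finset.mem_filter.1 hg).2
    have hDS : ∀ a, D a ⊆ S := fun a => Finset.filter_subset _ _
    have branch : ∀ a, Cov (fun g => (gs g).subst v a)
        (Agree (fun g => (gs g).subst v a) (S \ D a) fun g => if g ∈ S then c a g else b g)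
        (2 ^ (S \ D a).card) := by
      intro a
      refine ih _ _ _ (hK' a) fun g hg => ?_
      by_cases hgS : g ∈ S
      · simp [hc a g (by simpa [hgS] using hg), occ]
      · exact hS' a g hgS
    have agree : ∀ a z y, Agree gs S b z y → y v = a →
        Agree (fun g => (gs g).subst v a) (S \ D a)
          (fun g => if g ∈ S then c a g else b g) z y := by
      rintro a z y h rfl g hg
      by_cases hgS : g ∈ S
      · simp [hc _ g (by simpa [hgS] using hg), eval, hgS]
      · simpa [eval_subst, hgS] using h g hgS
    have hcard : ∀ a, (D a).Nonempty → 2 * 2 ^ (S \ D a).card ≤ 2 ^ S.card := by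
      intro a ha
      rw [← pow_succ']
      refine Nat.pow_le_pow_right two_pos ?_
      have := Finset.card_sdiff_add_card_eq_card (hDS a)
      have := ha.card_pos
      omega
    by_cases hne : (D !β).Nonempty
    · refine ((((branch β).subst (R := fun z y => Agree gs S b z y ∧ y v = β) ?_).union
        ((branch !β).subst (R := fun z y => Agree gs S b z y ∧ y v = !β) ?_) ?_)).mono ?_
      · exact fun z y hz => ⟨y, hz.2, fun _ => rfl, agree _ z y hz.1 hz.2⟩
      · exact fun z y hz => ⟨y, hz.2, fun _ => rfl, agree _ z y hz.1 hz.2⟩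
      · intro z y hz
        by_cases hv : y v = β
        · exact Or.inl ⟨hz, hv⟩
        · exact Or.inr ⟨hz, Bool.eq_not.2 hv⟩
      · have := hcard β ⟨_, hg₀D⟩
        have := hcard _ hne
        omega
    · obtain ⟨k, hk, hcov⟩ := cov_of_simple K ih (c β) (D β) (fun g => (gs g).subst v !β) S b
        (hK' _) (hS' _) (hDS β) fun g hg => simple_subst_not (hc β g hg)
      refine ((((branch β).subst (R := fun z y => Agree gs S b z y ∧
        (y v = β ∨ ∀ g ∈ D β, (gs g).eval z y = c β g)) ?_).union
        (hcov.subst (R := fun z y => Agree gs S b z y ∧ y v = (!β) ∧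
          ¬∀ g ∈ D β, (gs g).eval z y = c β g) ?_) ?_)).mono (by omega)
      · intro z y hz
        have heq : ∀ g, (gs g).eval z (Function.update y v β) = (gs g).eval z y := by
          intro g
          rcases hz.2 with rfl | hall
          · simp
          by_cases hgS : g ∈ S
          · by_cases hgD : g ∈ D β
            · rw [← eval_subst, hall g hgD, hc β g hgD, eval]
            · refine eval_update_of_not_absorbing (fun a e he => ?_) z y β
              by_cases ha : a = β
              · exact hgD (Finset.mem_filter.2 ⟨hgS, e, ha ▸ he⟩)
              · exact hne ⟨g, Finset.mem_filter.2 ⟨hgS, e, Bool.eq_not.2 ha ▸ he⟩⟩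
          · exact eval_of_occ_eq_zero (hS g hgS) _ _ _
        refine ⟨Function.update y v β, by simp, heq, agree _ _ _ (fun g hg => ?_) (by simp)⟩
        rw [heq]
        exact hz.1 g hg
      · rintro z y ⟨h1, h2, h3⟩
        refine ⟨y, h2, fun _ => rfl, ?_⟩
        simpa [Agree, eval_subst, ← h2] using And.intro h1 h3
      · intro z y hz
        by_cases hv : y v = β ∨ ∀ g ∈ D β, (gs g).eval z y = c β g
        · exact Or.inl ⟨hz, hv⟩
        · push Not at hv
          exact Or.inr ⟨hz, Bool.eq_not.2 hv.1, by simpa using hv.2⟩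

/-- All outputs of a layer of gates can be produced by `2 ^ |ι|` pairs of an output vector and
a guess vector. -/
theorem exists_cover (gs : ι → LayerGate Z V) :
    ∃ O : Finset ((ι → Bool) × (V → Bool)), O.card ≤ 2 ^ Fintype.card ι ∧ ∀ z y,
      ∃ o ∈ O, ∀ g, (gs g).eval z y = o.1 g ∧ (gs g).eval z o.2 = o.1 g := by
  obtain ⟨O, hO, h⟩ := cov_agree _ gs Finset.univ (fun _ => false) le_rfl (by simp)
  exact ⟨O, hO, fun z y => h z y fun g hg => (hg (Finset.mem_univ g)).elim⟩

end Cov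

end LayerGate

namespace CNode

variable {n m : ℕ}

/-- The value of a node, given a valuation `v` of its predecessors. -/
def val (x : Fin n → Bool) (y : Fin m → Bool) (v : ℕ → Bool) : CNode n m → Bool
  | actual a => x a
  | guess g  => y g
  | const b  => b
  | gand j k => v j && v k
  | gor j k  => v j || v k
  | gnot j   => !v j
  | gcopy j  => v j

theorem val_congr {x : Fin n → Bool} {y : Fin m → Bool} {u v : ℕ → Bool} (d : CNode n m)
    (h : ∀ j ∈ d.preds, u j = v j) : d.val x y u = d.val x y v := by
  cases d <;> simp_all [val, preds]

theorem val_congr_guess {x : Fin n → Bool} {y y' : Fin m → Bool} {u : ℕ → Bool} (d : CNode n m)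
    (h : d.isWide = true) : d.val x y u = d.val x y' u := by
  cases d <;> simp_all [val, isWide]

theorem isWide_of_mem_preds {d : CNode n m} {j : ℕ} (h : j ∈ d.preds) : d.isWide = true := by
  cases d <;> simp_all [preds, isWide]

theorem exists_mem_preds {d : CNode n m} (h : d.isWide = true) : ∃ j, j ∈ d.preds := by
  cases d <;> simp_all [preds, isWide]

theorem isWide_of_isGate {d : CNode n m} (h : d.isGate = true) : d.isWide = true := by
  cases d <;> simp_all [isGate, isWide]

end CNode

namespace Circuit

variable {n m : ℕ}

theorem evalAux_eq (c : Circuit n m) (x : Fin n → Bool) (y : Fin m → Bool) (i : ℕ)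
    (hi : i < c.N) : c.evalAux x y i = (c.node ⟨i, hi⟩).val x y (c.evalAux x y) := by
  have hwf := c.wf ⟨i, hi⟩
  rw [evalAux]
  simp only [nodeAt, hi, dif_pos]
  cases hd : c.node ⟨i, hi⟩ <;> simp_all [CNode.val, CNode.preds]

/-- A valuation satisfying the local equations on a predecessor-closed set `R` of nodes
agrees with the evaluation of the circuit on `R`. -/
theorem evalAux_eq_of_local (c : Circuit n m) (x : Fin n → Bool) (y : Fin m → Bool)
    (R : Fin c.N → Prop) (u : ℕ → Bool)
    (hR : ∀ i, R i → (∀ j ∈ (c.node i).preds, ∀ hj : j < c.N, R ⟨j, hj⟩) ∧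
      (c.node i).val x y u = u i) :
    ∀ i, R i → c.evalAux x y i = u i := by
  have key : ∀ k : ℕ, ∀ hk : k < c.N, R ⟨k, hk⟩ → c.evalAux x y k = u k := by
    intro k
    induction k using Nat.strong_induction_on with
    | _ k ih =>
      intro hk hRk
      obtain ⟨hp, hv⟩ := hR _ hRk
      rw [evalAux_eq c x y k hk, ← hv]
      refine CNode.val_congr _ fun j hj => ?_
      have hlt : j < k := c.wf _ j hj
      exact ih j hlt (hlt.trans hk) (hp j hj _)
  exact fun i hi => key i i.2 hi

/-- The number of wide nodes in layer `t`. -/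
def wideAt (c : Circuit n m) (ℓ : Fin c.N → ℕ) (t : ℕ) : ℕ :=
  (Finset.univ.filter (fun i : Fin c.N => ℓ i = t ∧ (c.node i).isWide = true)).card

/-- Some node in layer `t` computes `φ`. -/
def Has (c : Circuit n m) (ℓ : Fin c.N → ℕ) (t : ℕ)
    (φ : (Fin n → Bool) → (Fin m → Bool) → Bool) : Prop :=
  ∃ i : Fin c.N, ℓ i = t ∧ ∀ x y, c.evalAux x y i = φ x y

theorem pos_layer_of_isWide {c : Circuit n m} {ℓ : Fin c.N → ℕ} (hℓ : c.IsLayering ℓ)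
    {i : Fin c.N} (hi : (c.node i).isWide = true) : 0 < ℓ i := by
  obtain ⟨j, hj⟩ := CNode.exists_mem_preds hi
  have := hℓ i j hj ((c.wf i j hj).trans i.2)
  omega

/-- Append a node to a circuit. -/
def snoc (c : Circuit n m) (d : CNode n m) (hd : ∀ j ∈ d.preds, j < c.N)
    (hg : ∀ g, d ≠ CNode.guess g) : Circuit n m where
  N := c.N + 1
  node := Fin.snoc (α := fun _ => CNode n m) c.node d
  output := c.output.castSucc
  wf := by
    intro i
    refine Fin.lastCases ?_ (fun i => ?_) i
    · simpa using hd
    · simpa using c.wf i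
  guessOnce := by
    intro g
    have := c.guessOnce g
    rw [Finset.card_filter] at this ⊢
    rw [Fin.sum_univ_castSucc]
    simpa [hg g] using this

theorem exists_snoc (c : Circuit n m) {ℓ : Fin c.N → ℕ} (hℓ : c.IsLayering ℓ) (d : CNode n m)
    (t : ℕ) (hd : ∀ j ∈ d.preds, ∃ h : j < c.N, ℓ ⟨j, h⟩ + 1 = t)
    (hg : ∀ g, d ≠ CNode.guess g) :
    ∃ (c' : Circuit n m) (ℓ' : Fin c'.N → ℕ), c'.IsLayering ℓ' ∧
      (∀ r, c'.wideAt ℓ' r = c.wideAt ℓ r + if t = r ∧ d.isWide = true then 1 else 0) ∧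
      c'.size = c.size + (if d.isGate = true then 1 else 0) ∧
      (∀ r φ, c.Has ℓ r φ → c'.Has ℓ' r φ) ∧
      c'.Has ℓ' t (fun x y => d.val x y (c.evalAux x y)) := by
  have hev : ∀ x y, ∀ i : Fin c.N,
      (c.snoc d (fun j hj => (hd j hj).1) hg).evalAux x y i = c.evalAux x y i := by
    intro x y i
    refine evalAux_eq_of_local (c.snoc d (fun j hj => (hd j hj).1) hg) x y
      (fun i => (i : ℕ) < c.N) (c.evalAux x y) ?_ i.castSucc i.2
    intro i hi
    have hnode : (c.snoc d (fun j hj => (hd j hj).1) hg).node i = c.node ⟨i, hi⟩ :=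
      Fin.snoc_castSucc (α := fun _ => CNode n m) d c.node ⟨i, hi⟩
    rw [hnode]
    exact ⟨fun j hj _ => (c.wf _ j hj).trans hi, (evalAux_eq c x y i hi).symm⟩
  refine ⟨c.snoc d (fun j hj => (hd j hj).1) hg, Fin.snoc (α := fun _ => ℕ) ℓ t, ?_, ?_, ?_, ?_, ?_⟩
  · intro i
    have hsm : ∀ (j : ℕ) (h : j < c.N) (h' : j < c.N + 1),
        (Fin.snoc (α := fun _ => ℕ) ℓ t : Fin (c.N + 1) → ℕ) ⟨j, h'⟩ = ℓ ⟨j, h⟩ := fun j h h' =>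
      Fin.snoc_castSucc (α := fun _ => ℕ) t ℓ ⟨j, h⟩
    refine Fin.lastCases ?_ (fun i => ?_) i
    · intro j hj hjN
      have hj' : j ∈ d.preds := by simpa [snoc] using hj
      obtain ⟨h, e⟩ := hd j hj'
      exact (congrArg (· + 1) (hsm j h hjN)).trans
        (e.trans (Fin.snoc_last (α := fun _ => ℕ) t ℓ).symm)
    · intro j hj hjN
      have hj' : j ∈ (c.node i).preds := by simpa [snoc] using hj
      have h : j < c.N := (c.wf _ j hj').trans i.2
      exact (congrArg (· + 1) (hsm j h hjN)).trans
        ((hℓ i j hj' h).trans (Fin.snoc_castSucc (α := fun _ => ℕ) t ℓ i).symm)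
  · intro r
    unfold wideAt
    rw [Finset.card_filter, Finset.card_filter]
    refine (Fin.sum_univ_castSucc _).trans ?_
    simp [snoc]
  · unfold size
    rw [Finset.card_filter, Finset.card_filter]
    refine (Fin.sum_univ_castSucc _).trans ?_
    simp [snoc]
  · rintro r φ ⟨i, hi, h⟩
    refine ⟨i.castSucc, by simpa using hi, fun x y => ?_⟩
    rw [← h x y]
    exact hev x y i
  · refine ⟨Fin.last c.N, by simp, fun x y => ?_⟩
    refine (evalAux_eq _ x y c.N (Nat.lt_succ_self _)).trans ?_
    have hnode : (c.snoc d (fun j hj => (hd j hj).1) hg).node ⟨c.N, Nat.lt_succ_self _⟩ = d :=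
      Fin.snoc_last (α := fun _ => CNode n m) _ _
    rw [hnode]
    exact CNode.val_congr _ fun j hj => hev x y ⟨j, (hd j hj).1⟩

/-- Circuits of size at most `S` and width at most `W` whose layer `t` provides all functions
in `Φ`, whose layer `t + 1` has at most `k` wide nodes and provides all functions in `Ψ`, and
which have no wide nodes beyond. -/
def Provides (W S t k : ℕ) (Φ Ψ : Set ((Fin n → Bool) → (Fin m → Bool) → Bool)) : Prop :=
  ∃ (c : Circuit n m) (ℓ : Fin c.N → ℕ), c.IsLayering ℓ ∧ (∀ r, c.wideAt ℓ r ≤ W) ∧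
    (∀ r, t + 1 < r → c.wideAt ℓ r = 0) ∧ c.wideAt ℓ (t + 1) ≤ k ∧ c.size ≤ S ∧
    (∀ φ ∈ Φ, c.Has ℓ t φ) ∧ ∀ ψ ∈ Ψ, c.Has ℓ (t + 1) ψ

/-- The functions in `Φ`, the actual inputs and the constants. -/
def Source (Φ : Set ((Fin n → Bool) → (Fin m → Bool) → Bool)) :
    Set ((Fin n → Bool) → (Fin m → Bool) → Bool) :=
  {u | u ∈ Φ ∨ (∃ a, u = fun x _ => x a) ∨ ∃ b, u = fun _ _ => b}

/-- `Derivable Φ φ e`: one wide node computes `φ` from sources over `Φ`, at cost `e`. -/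
inductive Derivable (Φ : Set ((Fin n → Bool) → (Fin m → Bool) → Bool)) :
    ((Fin n → Bool) → (Fin m → Bool) → Bool) → ℕ → Prop
  | and {u v} : u ∈ Source Φ → v ∈ Source Φ → Derivable Φ (fun x y => u x y && v x y) 1
  | or {u v} : u ∈ Source Φ → v ∈ Source Φ → Derivable Φ (fun x y => u x y || v x y) 1
  | not {u} : u ∈ Source Φ → Derivable Φ (fun x y => !u x y) 1
  | copy {u} : u ∈ Source Φ → Derivable Φ u 0

theorem mem_source_of_mem {Φ : Set ((Fin n → Bool) → (Fin m → Bool) → Bool)}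
    {u : (Fin n → Bool) → (Fin m → Bool) → Bool} (h : u ∈ Φ) : u ∈ Source Φ := Or.inl h

theorem const_mem_source (Φ : Set ((Fin n → Bool) → (Fin m → Bool) → Bool)) (b : Bool) :
    (fun _ _ => b) ∈ Source Φ := Or.inr (Or.inr ⟨b, rfl⟩)

theorem source_mono {Φ Φ' : Set ((Fin n → Bool) → (Fin m → Bool) → Bool)} (h : Φ ⊆ Φ') :
    Source Φ ⊆ Source Φ' := fun _ hu => hu.imp_left fun h' => h h'

namespace Provides

variable {W S t k : ℕ} {Φ Ψ : Set ((Fin n → Bool) → (Fin m → Bool) → Bool)}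

theorem mono (h : Provides W S t k Φ Ψ) {S' : ℕ} {Φ' Ψ'} (hS : S ≤ S') (hΦ : Φ' ⊆ Φ)
    (hΨ : Ψ' ⊆ Ψ) : Provides W S' t k Φ' Ψ' := by
  obtain ⟨c, ℓ, h1, h2, h3, h4, h5, h6, h7⟩ := h
  exact ⟨c, ℓ, h1, h2, h3, h4, h5.trans hS, fun φ hφ => h6 φ (hΦ hφ), fun ψ hψ => h7 ψ (hΨ hψ)⟩

theorem source (h : Provides W S t k Φ Ψ) {u : (Fin n → Bool) → (Fin m → Bool) → Bool}
    (hu : u ∈ Source Φ) : Provides W S t k (insert u Φ) Ψ := by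
  obtain ⟨c, ℓ, h1, h2, h3, h4, h5, h6, h7⟩ := h
  have input : ∀ d : CNode n m, d.isWide = false → (∀ g, d ≠ CNode.guess g) →
      (∀ v x y, d.val x y v = u x y) → Provides W S t k (insert u Φ) Ψ := by
    intro d hw hg hval
    have hp : ∀ j, j ∉ d.preds := fun j hj => by simp [CNode.isWide_of_mem_preds hj] at hw
    obtain ⟨c', ℓ', a1, a2, a3, a4, a5⟩ := exists_snoc c h1 d t (fun j hj => (hp j hj).elim) hg
    have hgate : d.isGate = false := by
      by_contra hne
      simp [CNode.isWide_of_isGate (Bool.eq_true_of_not_eq_false hne)] at hw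
    simp only [hw, hgate, Bool.false_eq_true, and_false, if_false, add_zero] at a2 a3
    refine ⟨c', ℓ', a1, fun r => a2 r ▸ h2 r, fun r hr => a2 r ▸ h3 r hr, a2 _ ▸ h4, a3 ▸ h5, ?_,
      fun ψ hψ => a4 _ _ (h7 ψ hψ)⟩
    intro φ hφ
    rcases hφ with rfl | hφ
    · obtain ⟨i, hi, e⟩ := a5
      exact ⟨i, hi, fun x y => (e x y).trans (hval _ x y)⟩
    · exact a4 _ _ (h6 φ hφ)
  rcases hu with hu | ⟨a, rfl⟩ | ⟨b, rfl⟩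
  · rw [Set.insert_eq_of_mem hu]
    exact ⟨c, ℓ, h1, h2, h3, h4, h5, h6, h7⟩
  · exact input (CNode.actual a) rfl (by simp) fun _ _ _ => rfl
  · exact input (CNode.const b) rfl (by simp) fun _ _ _ => rfl

theorem gate (h : Provides W S t k Φ Ψ) (hk : k < W) {u v : (Fin n → Bool) → (Fin m → Bool) → Bool}
    (hu : u ∈ Φ) (hv : v ∈ Φ) (mk : ℕ → ℕ → CNode n m) (e : ℕ) (op : Bool → Bool → Bool)
    (hw : ∀ j k, (mk j k).isWide = true) (hg : ∀ j k, (if (mk j k).isGate = true then 1 else 0) = e)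
    (hp : ∀ j k, ∀ i ∈ (mk j k).preds, i = j ∨ i = k)
    (hop : ∀ j k x y w, (mk j k).val x y w = op (w j) (w k)) :
    Provides W (S + e) t (k + 1) Φ (insert (fun x y => op (u x y) (v x y)) Ψ) := by
  obtain ⟨c, ℓ, h1, h2, h3, h4, h5, h6, h7⟩ := h
  obtain ⟨i, hi, ei⟩ := h6 u hu
  obtain ⟨j, hj, ej⟩ := h6 v hv
  obtain ⟨c', ℓ', a1, a2, a3, a4, a5⟩ := exists_snoc c h1 (mk i j) (t + 1) (by
    intro r hr
    rcases hp _ _ r hr with rfl | rfl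
    · exact ⟨i.2, by rw [hi]⟩
    · exact ⟨j.2, by rw [hj]⟩) (by
    intro g hg
    have := hw i j
    simp [hg, CNode.isWide] at this)
  simp only [hw, and_true] at a2
  rw [hg] at a3
  refine ⟨c', ℓ', a1, fun r => ?_, fun r hr => ?_, ?_, by omega,
    fun φ hφ => a4 _ _ (h6 φ hφ), ?_⟩
  · rw [a2]
    split_ifs with hr
    · subst hr
      omega
    · exact h2 r
  · rw [a2, h3 r hr, if_neg (by omega)]
  · rw [a2, if_pos rfl]
    omega
  · intro ψ hψ
    rcases hψ with rfl | hψ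
    · obtain ⟨i', hi', e'⟩ := a5
      exact ⟨i', hi', fun x y => (e' x y).trans (by simp only [hop, ei, ej])⟩
    · exact a4 _ _ (h7 ψ hψ)

theorem derive (h : Provides W S t k Φ Ψ) (hk : k < W)
    {φ : (Fin n → Bool) → (Fin m → Bool) → Bool} {e : ℕ} (hφ : Derivable Φ φ e) :
    Provides W (S + e) t (k + 1) Φ (insert φ Ψ) := by
  have two : ∀ {u v}, u ∈ Source Φ → v ∈ Source Φ →
      Provides W S t k (insert v (insert u Φ)) Ψ := fun hu hv =>
    (h.source hu).source (source_mono (Set.subset_insert _ _) hv)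
  have sub : ∀ u v, Φ ⊆ insert v (insert u Φ) := fun u v =>
    (Set.subset_insert _ _).trans (Set.subset_insert _ _)
  cases hφ with
  | @and u v hu hv =>
    exact ((two hu hv).gate hk (u := u) (v := v) (by simp) (by simp) CNode.gand 1 (· && ·)
      (by simp [CNode.isWide]) (by simp [CNode.isGate]) (by simp [CNode.preds])
      (by simp [CNode.val])).mono le_rfl (sub u v) le_rfl
  | @or u v hu hv =>
    exact ((two hu hv).gate hk (u := u) (v := v) (by simp) (by simp) CNode.gor 1 (· || ·)
      (by simp [CNode.isWide]) (by simp [CNode.isGate]) (by simp [CNode.preds])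
      (by simp [CNode.val])).mono le_rfl (sub u v) le_rfl
  | @not u hu =>
    exact ((two hu hu).gate hk (u := u) (v := u) (by simp) (by simp) (fun j _ => CNode.gnot j) 1
      (fun a _ => !a) (by simp [CNode.isWide]) (by simp [CNode.isGate]) (by simp [CNode.preds])
      (by simp [CNode.val])).mono le_rfl (sub u u) le_rfl
  | copy hu =>
    exact ((two hu hu).gate hk (u := φ) (v := φ) (by simp) (by simp) (fun j _ => CNode.gcopy j) 0
      (fun a _ => a) (by simp [CNode.isWide]) (by simp [CNode.isGate]) (by simp [CNode.preds])
      (by simp [CNode.val])).mono le_rfl (sub φ φ) le_rfl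

/-- Move on to the next layer, whose functions are listed together with their costs. -/
theorem layer (h : Provides W S t 0 Φ ∅)
    (L : List (((Fin n → Bool) → (Fin m → Bool) → Bool) × ℕ))
    (hL : ∀ p ∈ L, Derivable Φ p.1 p.2) (hW : L.length ≤ W) :
    Provides W (S + (L.map Prod.snd).sum) (t + 1) 0 {φ | φ ∈ L.map Prod.fst} ∅ := by
  have key : ∀ L : List (((Fin n → Bool) → (Fin m → Bool) → Bool) × ℕ),
      (∀ p ∈ L, Derivable Φ p.1 p.2) → L.length ≤ W →
      Provides W (S + (L.map Prod.snd).sum) t L.length Φ {φ | φ ∈ L.map Prod.fst} := by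
    intro L
    induction L with
    | nil => exact fun _ _ => h.mono (by simp) le_rfl (by simp)
    | cons p L ih =>
      intro hL hW
      have := (ih (fun q hq => hL q (by simp [hq])) (by simp at hW; omega)).derive
        (by simp at hW; omega) (hL p (by simp))
      refine this.mono (by simp; omega) le_rfl ?_
      intro φ hφ
      simpa using hφ
  obtain ⟨c, ℓ, h1, h2, h3, -, h5, -, h7⟩ := key L hL hW
  exact ⟨c, ℓ, h1, h2, fun r hr => h3 r (by omega), (h3 _ (by omega)).le, h5, h7, by simp⟩

end Provides

/-- Redirect the output of a circuit. -/
def withOutput (c : Circuit n m) (i : Fin c.N) : Circuit n m := { c with output := i }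

theorem evalAux_withOutput (c : Circuit n m) (i : Fin c.N) (x : Fin n → Bool) (y : Fin m → Bool)
    (j : Fin c.N) : (c.withOutput i).evalAux x y j = c.evalAux x y j :=
  evalAux_eq_of_local (c.withOutput i) x y (fun _ => True) (c.evalAux x y)
    (fun r _ => ⟨fun _ _ _ => trivial, (evalAux_eq c x y r r.2).symm⟩) j trivial

theorem Provides.exists_circuit {W S t k : ℕ}
    {Φ Ψ : Set ((Fin n → Bool) → (Fin m → Bool) → Bool)} (h : Provides W S t k Φ Ψ)
    {φ : (Fin n → Bool) → (Fin m → Bool) → Bool} (hφ : φ ∈ Φ) :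
    ∃ c : Circuit n m, c.eval = φ ∧ c.size ≤ S ∧ c.HasWidth W := by
  obtain ⟨c, ℓ, h1, h2, -, -, h5, h6, -⟩ := h
  obtain ⟨i, -, e⟩ := h6 φ hφ
  exact ⟨c.withOutput i, funext₂ fun x y => (evalAux_withOutput c i x y i).trans (e x y), h5, ℓ,
    h1, h2⟩

/-- Functions provided by the current layer can be conjoined at a cost of one per conjunction. -/
theorem Provides.conj {W : ℕ} : ∀ (S : ℕ) (q : List ((Fin n → Bool) → (Fin m → Bool) → Bool))
    (t : ℕ), Provides W S t 0 {φ | φ ∈ q} ∅ → q.length ≤ W → 0 < W →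
    ∃ c : Circuit n m, (∀ x y, c.eval x y = true ↔ ∀ φ ∈ q, φ x y = true) ∧
      c.size ≤ S + (q.length - 1) ∧ c.HasWidth W
  | S, [], t, h, _, hW => by
    obtain ⟨c, hc, hs, hw⟩ := (h.layer [(fun _ _ => true, 0)]
      (by simpa using Derivable.copy (const_mem_source _ true)) (by simp; omega)).exists_circuit
      (φ := fun _ _ => true) (by simp)
    exact ⟨c, by simp [hc], by simpa using hs, hw⟩
  | S, [φ], t, h, _, hW => by
    obtain ⟨c, hc, hs, hw⟩ := h.exists_circuit (φ := φ) (by simp)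
    exact ⟨c, by simp [hc], by simpa using hs, hw⟩
  | S, φ :: ψ :: q, t, h, hl, hW => by
    have h' := h.layer ((fun x y => φ x y && ψ x y, 1) :: q.map fun u => (u, 0)) (by
      intro p hp
      rcases List.mem_cons.1 hp with rfl | hp
      · exact .and (mem_source_of_mem (by simp)) (mem_source_of_mem (by simp))
      · obtain ⟨u, hu, rfl⟩ := List.mem_map.1 hp
        exact .copy (mem_source_of_mem (by simp [hu]))) (by simp at hl ⊢; omega)
    obtain ⟨c, hc, hs, hw⟩ := Provides.conj (S + 1) ((fun x y => φ x y && ψ x y) :: q) (t + 1)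
      (h'.mono (by simp [Function.comp_def]) (by simp [Function.comp_def]) le_rfl)
      (by simp at hl ⊢; omega) hW
    exact ⟨c, fun x y => by simp [hc, and_assoc], by simp at hs ⊢; omega, hw⟩

/-- Literals over the current layer can be conjoined at a cost of one per literal. -/
theorem Provides.conj_literals {W : ℕ} :
    ∀ (S : ℕ) (p q : List ((Fin n → Bool) → (Fin m → Bool) → Bool))
    (t : ℕ), Provides W S t 0 {φ | φ ∈ p ++ q} ∅ → p.length + q.length ≤ W → 0 < W →
    ∃ c : Circuit n m, (∀ x y, c.eval x y = true ↔
        (∀ φ ∈ p, φ x y = false) ∧ ∀ φ ∈ q, φ x y = true) ∧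
      c.size ≤ S + (p.length + q.length) ∧ c.HasWidth W
  | S, [], q, t, h, hl, hW => by
    obtain ⟨c, hc, hs, hw⟩ := Provides.conj S q t (by simpa using h) (by simpa using hl) hW
    exact ⟨c, by simp [hc], by simp; omega, hw⟩
  | S, [φ], q, t, h, hl, hW => by
    have h' := h.layer ((fun x y => !φ x y, 1) :: q.map fun u => (u, 0)) (by
      intro p hp
      rcases List.mem_cons.1 hp with rfl | hp
      · exact .not (mem_source_of_mem (by simp))
      · obtain ⟨u, hu, rfl⟩ := List.mem_map.1 hp
        exact .copy (mem_source_of_mem (by simp [hu]))) (by simp at hl ⊢; omega)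
    obtain ⟨c, hc, hs, hw⟩ := Provides.conj (S + 1) ((fun x y => !φ x y) :: q) (t + 1)
      (h'.mono (by simp [Function.comp_def]) (by simp [Function.comp_def]) le_rfl)
      (by simp at hl ⊢; omega) hW
    exact ⟨c, fun x y => by simp [hc], by simp at hs ⊢; omega, hw⟩
  | S, φ :: ψ :: p, q, t, h, hl, hW => by
    have h' := h.layer ((fun x y => φ x y || ψ x y, 1) :: (p ++ q).map fun u => (u, 0)) (by
      intro r hr
      rcases List.mem_cons.1 hr with rfl | hr
      · exact .or (mem_source_of_mem (by simp)) (mem_source_of_mem (by simp))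
      · obtain ⟨u, hu, rfl⟩ := List.mem_map.1 hr
        exact .copy (mem_source_of_mem (by simp at hu ⊢; tauto))) (by simp at hl ⊢; omega)
    obtain ⟨c, hc, hs, hw⟩ := Provides.conj_literals (S + 1) ((fun x y => φ x y || ψ x y) :: p) q
      (t + 1) (h'.mono (by simp [Function.comp_def]) (by simp [Function.comp_def]) le_rfl)
      (by simp at hl ⊢; omega) hW
    exact ⟨c, fun x y => by simp [hc, and_assoc], by simp at hs ⊢; omega, hw⟩

theorem Provides.nil (n m W : ℕ) : Provides (n := n) (m := m) W 0 0 0 ∅ ∅ := by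
  refine ⟨⟨1, fun _ => CNode.const false, 0, by simp [CNode.preds], by simp⟩, fun _ => 0, ?_, ?_,
    ?_, ?_, ?_, by simp, by simp⟩ <;>
  simp [IsLayering, wideAt, size, CNode.preds, CNode.isWide, CNode.isGate]

/-- The number of gates in the layers up to `t`. -/
def gatesUpTo (c : Circuit n m) (ℓ : Fin c.N → ℕ) (t : ℕ) : ℕ :=
  (Finset.univ.filter fun i : Fin c.N => ℓ i ≤ t ∧ (c.node i).isGate = true).card

theorem gatesUpTo_succ (c : Circuit n m) (ℓ : Fin c.N → ℕ) (t : ℕ) :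
    c.gatesUpTo ℓ (t + 1) = c.gatesUpTo ℓ t +
      ∑ i with ℓ i = t + 1 ∧ (c.node i).isWide = true,
        if (c.node i).isGate = true then 1 else 0 := by
  rw [gatesUpTo, gatesUpTo, ← Finset.card_filter, Finset.filter_filter,
    ← Finset.card_union_of_disjoint]
  · congr 1
    ext i
    have := CNode.isWide_of_isGate (d := c.node i)
    simp only [Finset.mem_filter, Finset.mem_univ, true_and, Finset.mem_union]
    constructor
    · rintro ⟨h1, h2⟩
      rcases Nat.le_succ_iff.1 h1 with h | h
      · exact Or.inl ⟨h, h2⟩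
      · exact Or.inr ⟨⟨h, this h2⟩, h2⟩
    · rintro (⟨h1, h2⟩ | ⟨⟨h1, -⟩, h2⟩)
      · exact ⟨h1.trans (Nat.le_succ t), h2⟩
      · exact ⟨h1.le, h2⟩
  · refine Finset.disjoint_filter.2 fun i _ h1 h2 => ?_
    omega

/-- Run a deterministic circuit next to two stored functions. -/
theorem Provides.run {W S t : ℕ} {a b : (Fin n → Bool) → (Fin 0 → Bool) → Bool}
    (h : Provides (W + 2) S t 0 {a, b} ∅) (D : Circuit n 0) {ℓ : Fin D.N → ℕ}
    (hℓ : D.IsLayering ℓ) (hW : ∀ r, D.wideAt ℓ r ≤ W) (r : ℕ) :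
    Provides (W + 2) (S + D.gatesUpTo ℓ r) (t + r) 0 {φ | φ = a ∨ φ = b ∨ ∃ i, ℓ i = r ∧
      (D.node i).isWide = true ∧ φ = fun x y => D.evalAux x y i} ∅ ∧
    ∀ i, ℓ i = r → (fun x y => D.evalAux x y i) ∈ Source {φ | φ = a ∨ φ = b ∨ ∃ i, ℓ i = r ∧
      (D.node i).isWide = true ∧ φ = fun x y => D.evalAux x y i} := by
  have src : ∀ r i, ℓ i = r → (fun x y => D.evalAux x y i) ∈ Source {φ | φ = a ∨ φ = b ∨
      ∃ i, ℓ i = r ∧ (D.node i).isWide = true ∧ φ = fun x y => D.evalAux x y i} := by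
    intro r i hi
    by_cases hw : (D.node i).isWide = true
    · exact mem_source_of_mem (Or.inr (Or.inr ⟨i, hi, hw, rfl⟩))
    · have he := fun x y => evalAux_eq D x y i i.2
      cases hd : D.node i with
      | actual u => exact Or.inr (Or.inl ⟨u, funext₂ fun x y => by simp [he, hd, CNode.val]⟩)
      | guess g => exact g.elim0
      | const u => exact Or.inr (Or.inr ⟨u, funext₂ fun x y => by simp [he, hd, CNode.val]⟩)
      | _ => simp [hd, CNode.isWide] at hw
  refine ⟨?_, src r⟩
  induction r with
  | zero =>
    refine h.mono (Nat.le_add_right _ _) ?_ le_rfl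
    rintro φ (rfl | rfl | ⟨i, hi, hw, -⟩)
    · simp
    · simp
    · have := pos_layer_of_isWide hℓ hw
      omega
  | succ r ih =>
    have h' := ih.layer ((a, 0) :: (b, 0) ::
      (Finset.univ.filter fun i => ℓ i = r + 1 ∧ (D.node i).isWide = true).toList.map
        fun i : Fin D.N => (fun x y => D.evalAux x y i, if (D.node i).isGate = true then 1 else 0))
      ?_ (by simpa [wideAt] using hW (r + 1))
    · refine h'.mono ?_ ?_ le_rfl
      · simp [gatesUpTo_succ, Finset.sum_map_toList, Function.comp_def, add_assoc]
      · rintro φ (rfl | rfl | ⟨i, hi, hw, rfl⟩)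
        · simp
        · simp
        · simp only [List.map_cons, List.map_map, Set.mem_ofPred_eq, List.mem_cons, List.mem_map]
          exact Or.inr (Or.inr ⟨i, by simp [hi, hw], rfl⟩)
    · intro p hp
      rcases List.mem_cons.1 hp with rfl | hp
      · exact .copy (mem_source_of_mem (Or.inl rfl))
      rcases List.mem_cons.1 hp with rfl | hp
      · exact .copy (mem_source_of_mem (Or.inr (Or.inl rfl)))
      obtain ⟨i, hi, rfl⟩ := List.mem_map.1 hp
      obtain ⟨hi, hw⟩ : ℓ i = r + 1 ∧ (D.node i).isWide = true := by simpa using hi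
      have hp : ∀ j, j ∈ (D.node i).preds → (fun x y => D.evalAux x y j) ∈ Source {φ | φ = a ∨
          φ = b ∨ ∃ i, ℓ i = r ∧ (D.node i).isWide = true ∧ φ = fun x y => D.evalAux x y i} := by
        intro j hj
        have hjN := (D.wf i j hj).trans i.2
        refine src r ⟨j, hjN⟩ ?_
        have := hℓ i j hj hjN
        omega
      have he : (fun x y => D.evalAux x y i) =
          fun x y => (D.node i).val x y (D.evalAux x y) := funext₂ fun x y => evalAux_eq D x y i i.2
      simp only [he]
      cases hd : D.node i with
      | gand j k => exact .and (hp j (by simp [hd, CNode.preds])) (hp k (by simp [hd, CNode.preds]))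
      | gor j k => exact .or (hp j (by simp [hd, CNode.preds])) (hp k (by simp [hd, CNode.preds]))
      | gnot j => exact .not (hp j (by simp [hd, CNode.preds]))
      | gcopy j => exact .copy (hp j (by simp [hd, CNode.preds]))
      | _ => simp [hd, CNode.isWide] at hw

theorem Provides.and_eval {W S t : ℕ} {a b : (Fin n → Bool) → (Fin 0 → Bool) → Bool}
    (h : Provides (W + 2) S t 0 {a, b} ∅) (D : Circuit n 0) (hD : D.HasWidth W) :
    ∃ t', Provides (W + 2) (S + (D.size + 1)) t' 0 {a, fun x y => b x y && D.eval x y} ∅ := by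
  obtain ⟨ℓ, hℓ, hW⟩ := hD
  obtain ⟨h1, h2⟩ := h.run D hℓ hW (ℓ D.output)
  have h3 := h1.layer [(a, 0), (fun x y => b x y && D.eval x y, 1)] (by
    simp only [List.mem_cons, List.not_mem_nil, or_false, forall_eq_or_imp, forall_eq]
    exact ⟨.copy (mem_source_of_mem (Or.inl rfl)),
      .and (mem_source_of_mem (Or.inr (Or.inl rfl))) (h2 D.output rfl)⟩) (by simp)
  have hle : D.gatesUpTo ℓ (ℓ D.output) ≤ D.size :=
    Finset.card_le_card fun i hi => by simp_all
  refine ⟨_, h3.mono (by simp; omega) (by simp [Set.subset_def]) le_rfl⟩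

theorem Provides.and_evals {W s : ℕ} {a : (Fin n → Bool) → (Fin 0 → Bool) → Bool}
    (Ds : List (Circuit n 0)) : ∀ {S t : ℕ} {b : (Fin n → Bool) → (Fin 0 → Bool) → Bool},
    Provides (W + 2) S t 0 {a, b} ∅ → (∀ D ∈ Ds, D.size ≤ s ∧ D.HasWidth W) →
    ∃ t' b', Provides (W + 2) (S + Ds.length * (s + 1)) t' 0 {a, b'} ∅ ∧
      ∀ x y, b' x y = true ↔ b x y = true ∧ ∀ D ∈ Ds, D.eval x y = true := by
  induction Ds with
  | nil => exact fun {S t b} h _ => ⟨t, b, by simpa using h, by simp⟩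
  | cons D Ds ih =>
    intro S t b h hDs
    obtain ⟨hs, hw⟩ := hDs D (by simp)
    obtain ⟨t₁, h₁⟩ := h.and_eval D hw
    obtain ⟨t₂, b₂, h₂, e⟩ := ih h₁ fun D' hD' => hDs D' (by simp [hD'])
    refine ⟨t₂, b₂, h₂.mono ?_ le_rfl le_rfl, fun x y => by simp [e, and_assoc]⟩
    rw [List.length_cons, add_mul, one_mul]
    omega

/-- A disjunction of conjunctions of deterministic circuits can be computed by evaluating the
circuits one after the other. -/
theorem exists_or_and {W s r : ℕ} (Os : List (List (Circuit n 0)))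
    (hOs : ∀ Ds ∈ Os, Ds.length ≤ r ∧ ∀ D ∈ Ds, D.size ≤ s ∧ D.HasWidth W) :
    ∃ E : Circuit n 0, (∀ x y, E.eval x y = true ↔ ∃ Ds ∈ Os, ∀ D ∈ Ds, D.eval x y = true) ∧
      E.size ≤ Os.length * (r * (s + 1) + 1) ∧ E.HasWidth (W + 2) := by
  have key : ∃ t a, Provides (n := n) (m := 0) (W + 2) (Os.length * (r * (s + 1) + 1)) t 0 {a} ∅ ∧
      ∀ x y, a x y = true ↔ ∃ Ds ∈ Os, ∀ D ∈ Ds, D.eval x y = true := by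
    induction Os with
    | nil =>
      refine ⟨_, fun _ _ => false, ((Provides.nil n 0 (W + 2)).layer [(fun _ _ => false, 0)] ?_
        (by simp)).mono (by simp) (by simp) le_rfl, by simp⟩
      simpa using Derivable.copy (const_mem_source _ false)
    | cons Ds Os ih =>
      obtain ⟨t, a, h, ha⟩ := ih fun Ds' h' => hOs Ds' (by simp [h'])
      obtain ⟨hr, hDs⟩ := hOs Ds (by simp)
      have h₁ := h.layer [(a, 0), (fun _ _ => true, 0)] (by
        simp only [List.mem_cons, List.not_mem_nil, or_false, forall_eq_or_imp, forall_eq]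
        exact ⟨.copy (mem_source_of_mem rfl), .copy (const_mem_source _ true)⟩) (by simp)
      obtain ⟨t₂, b, h₂, hb⟩ := Provides.and_evals Ds (a := a) (b := fun _ _ => true)
        (h₁.mono le_rfl (by simp [Set.subset_def]) le_rfl) hDs
      have h₃ := h₂.layer [(fun x y => a x y || b x y, 1)] (by
        simp only [List.mem_cons, List.not_mem_nil, or_false, forall_eq]
        exact .or (mem_source_of_mem (by simp)) (mem_source_of_mem (by simp))) (by simp)
      refine ⟨_, fun x y => a x y || b x y, h₃.mono ?_ (by simp) le_rfl, fun x y => ?_⟩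
      · have := Nat.mul_le_mul_right (s + 1) hr
        simp [add_mul] at this ⊢
        omega
      · simp [ha, hb, or_comm]
  obtain ⟨t, a, h, ha⟩ := key
  obtain ⟨E, rfl, hs, hw⟩ := h.exists_circuit (φ := a) rfl
  exact ⟨E, ha, hs, hw⟩

/-- A relabeling of the nodes of a circuit that only removes wires and guesses. -/
structure IsRelabeling (c : Circuit n m) (σ : Fin c.N → CNode n m) : Prop where
  preds : ∀ i, (σ i).preds ⊆ (c.node i).preds
  guess : ∀ i g, σ i = CNode.guess g → c.node i = CNode.guess g

/-- The relabeled circuit. -/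
abbrev relabel (c : Circuit n m) (σ : Fin c.N → CNode n m) (h : c.IsRelabeling σ) :
    Circuit n m where
  N := c.N
  node := σ
  output := c.output
  wf i j hj := c.wf i j (h.preds i hj)
  guessOnce g := (Finset.card_le_card (Finset.monotone_filter_right _ fun i _ => h.guess i g)).trans
    (c.guessOnce g)

section Relabel

variable {c : Circuit n m} {σ : Fin c.N → CNode n m} {ℓ : Fin c.N → ℕ} {w : ℕ}

theorem IsRelabeling.isWide (h : c.IsRelabeling σ) {i : Fin c.N} (hi : (σ i).isWide = true) :
    (c.node i).isWide = true := by
  obtain ⟨j, hj⟩ := CNode.exists_mem_preds hi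
  exact CNode.isWide_of_mem_preds (h.preds i hj)

theorem IsRelabeling.isLayering (h : c.IsRelabeling σ) (hℓ : c.IsLayering ℓ) :
    (c.relabel σ h).IsLayering ℓ := fun i j hj hjN => hℓ i j (h.preds i hj) hjN

theorem IsRelabeling.wideAt_le (h : c.IsRelabeling σ) (t : ℕ) :
    (c.relabel σ h).wideAt ℓ t ≤ c.wideAt ℓ t := by
  refine Finset.card_le_card fun i hi => ?_
  rw [Finset.mem_filter] at hi ⊢
  exact ⟨hi.1, hi.2.1, h.isWide hi.2.2⟩

theorem IsRelabeling.hasWidth (h : c.IsRelabeling σ) (hℓ : c.IsLayering ℓ)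
    (hw : ∀ t, c.wideAt ℓ t ≤ w) : (c.relabel σ h).HasWidth w :=
  ⟨ℓ, h.isLayering hℓ, fun t => (h.wideAt_le t).trans (hw t)⟩

end Relabel

open Classical in
/-- Take the guesses labeling nodes in `P` from `y'` and all others from `y`. -/
noncomputable def mix (c : Circuit n m) (P : Fin c.N → Prop) (y' y : Fin m → Bool) : Fin m → Bool :=
  fun g => if ∃ i, c.node i = CNode.guess g ∧ P i then y' g else y g

theorem node_injective_guess (c : Circuit n m) {g : Fin m} {i j : Fin c.N}
    (hi : c.node i = CNode.guess g) (hj : c.node j = CNode.guess g) : i = j :=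
  Finset.card_le_one.1 (c.guessOnce g) i (by simp [hi]) j (by simp [hj])

theorem mix_of_mem {c : Circuit n m} {P : Fin c.N → Prop} {y' y : Fin m → Bool} {g : Fin m}
    {i : Fin c.N} (hi : c.node i = CNode.guess g) (h : P i) : c.mix P y' y g = y' g :=
  if_pos ⟨i, hi, h⟩

theorem mix_of_notMem {c : Circuit n m} {P : Fin c.N → Prop} {y' y : Fin m → Bool} {g : Fin m}
    {i : Fin c.N} (hi : c.node i = CNode.guess g) (h : ¬P i) : c.mix P y' y g = y g :=
  if_neg fun ⟨_, hj, hP⟩ => h (c.node_injective_guess hi hj ▸ hP)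

theorem mix_false (c : Circuit n m) (y' y : Fin m → Bool) : c.mix (fun _ => False) y' y = y := by
  funext g
  simp [mix]

theorem mix_self (c : Circuit n m) (P : Fin c.N → Prop) (y : Fin m → Bool) : c.mix P y y = y := by
  funext g
  simp [mix]

/-- The value of a node depends only on the guesses below it. -/
theorem evalAux_congr_guess (c : Circuit n m) (x : Fin n → Bool) {y y' : Fin m → Bool}
    (R : Fin c.N → Prop) (hR : ∀ i, R i → ∀ j ∈ (c.node i).preds, ∀ hj : j < c.N, R ⟨j, hj⟩)
    (hy : ∀ i g, R i → c.node i = CNode.guess g → y g = y' g) (i : Fin c.N) (hi : R i) :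
    c.evalAux x y i = c.evalAux x y' i := by
  refine evalAux_eq_of_local c x y R _ (fun i hi => ⟨hR i hi, ?_⟩) i hi
  rw [evalAux_eq c x y' i i.2]
  cases hd : c.node i with
  | guess g => exact hy i g hi hd
  | _ => rfl

open Classical in
/-- Replace the guesses on `P` by constants and drop the wide nodes outside of `K`. -/
noncomputable def restrictNode (c : Circuit n m) (P K : Fin c.N → Prop) (y' : Fin m → Bool)
    (i : Fin c.N) : CNode n m :=
  match c.node i with
  | CNode.guess g => if P i then CNode.const (y' g) else CNode.guess g
  | d => if d.isWide = true ∧ ¬K i then CNode.const false else d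

theorem isRelabeling_restrictNode (c : Circuit n m) (P K : Fin c.N → Prop) (y' : Fin m → Bool) :
    c.IsRelabeling (c.restrictNode P K y') where
  preds i := by
    unfold restrictNode
    split
    · split_ifs <;> simp [CNode.preds]
    · split_ifs <;> simp [CNode.preds]
  guess i g := by
    unfold restrictNode
    split
    · next h => split_ifs <;> simp [h]
    · split_ifs <;> simp

/-- The circuit obtained by replacing guesses on `P` by constants and dropping the wide nodes
outside of `K`. -/
noncomputable abbrev restrict (c : Circuit n m) (P K : Fin c.N → Prop) (y' : Fin m → Bool) :
    Circuit n m :=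
  c.relabel (c.restrictNode P K y') (c.isRelabeling_restrictNode P K y')

theorem restrictNode_of_isWide {c : Circuit n m} {P K : Fin c.N → Prop} {y' : Fin m → Bool}
    {i : Fin c.N} (hi : (c.node i).isWide = true) (hK : K i) :
    c.restrictNode P K y' i = c.node i := by
  unfold restrictNode
  split
  · next h => simp [h, CNode.isWide] at hi
  · simp [hK]

theorem mem_of_isWide_restrictNode {c : Circuit n m} {P K : Fin c.N → Prop} {y' : Fin m → Bool}
    {i : Fin c.N} (hi : (c.restrictNode P K y' i).isWide = true) : K i := by
  have hw := (c.isRelabeling_restrictNode P K y').isWide hi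
  by_contra hK
  revert hi
  unfold restrictNode
  split
  · next h => simp [h, CNode.isWide] at hw
  · rw [if_pos ⟨hw, hK⟩]
    simp [CNode.isWide]

theorem size_restrict_le (c : Circuit n m) (P : Fin c.N → Prop) (K : Finset (Fin c.N))
    (y' : Fin m → Bool) :
    (c.restrict P (· ∈ K) y').size ≤ (K.filter fun i => (c.node i).isGate = true).card := by
  refine Finset.card_le_card fun i hi => ?_
  have hg : (c.restrictNode P (· ∈ K) y' i).isGate = true := (Finset.mem_filter.1 hi).2
  have hw := CNode.isWide_of_isGate hg
  have hK := mem_of_isWide_restrictNode hw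
  rw [restrictNode_of_isWide ((c.isRelabeling_restrictNode _ _ _).isWide hw) hK] at hg
  exact Finset.mem_filter.2 ⟨hK, hg⟩

theorem evalAux_restrict {c : Circuit n m} {P K : Fin c.N → Prop}
    (hK : ∀ i, K i → ∀ j ∈ (c.node i).preds, ∀ hj : j < c.N,
      (c.node ⟨j, hj⟩).isWide = true → K ⟨j, hj⟩)
    (x : Fin n → Bool) (y' y : Fin m → Bool) (i : Fin c.N) (hi : (c.node i).isWide = true → K i) :
    (c.restrict P K y').evalAux x y i = c.evalAux x (c.mix P y' y) i := by
  refine evalAux_eq_of_local (c.restrict P K y') x y (fun i => (c.node i).isWide = true → K i)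
    (c.evalAux x (c.mix P y' y)) (fun i hi => ⟨fun j hj hjN => ?_, ?_⟩) i hi
  · have hj := (c.isRelabeling_restrictNode P K y').preds i hj
    exact hK i (hi (CNode.isWide_of_mem_preds hj)) j hj hjN
  · rw [evalAux_eq c _ _ _ i.2]
    change (c.restrictNode P K y' i).val x y _ = (c.node i).val x _ _
    by_cases hw : (c.node i).isWide = true
    · rw [restrictNode_of_isWide hw (hi hw)]
      exact CNode.val_congr_guess _ hw
    · unfold restrictNode
      split
      · next g h =>
        split_ifs with hP
        · simp [CNode.val, h, mix_of_mem h hP]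
        · simp [CNode.val, h, mix_of_notMem h hP]
      · next h =>
        rw [if_neg fun h => hw h.1]
        cases hd : c.node i with
        | guess g => exact (h g hd).elim
        | actual => rfl
        | const => rfl
        | _ => simp [hd, CNode.isWide] at hw

/-- A circuit that checks whether the wide nodes of layer `t` in `A` have the values `b`. -/
theorem exists_check {c : Circuit n m} {ℓ : Fin c.N → ℕ} {w : ℕ} (hℓ : c.IsLayering ℓ)
    (hw : ∀ t, c.wideAt ℓ t ≤ w) (hw0 : 0 < w) (P : Fin c.N → Prop) (y' : Fin m → Bool)
    (b : Fin c.N → Bool) {t : ℕ} {K A : Finset (Fin c.N)} (hKt : ∀ i ∈ K, ℓ i ≤ t)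
    (hK : ∀ i ∈ K, ∀ j ∈ (c.node i).preds, ∀ hj : j < c.N,
      (c.node ⟨j, hj⟩).isWide = true → ⟨j, hj⟩ ∈ K)
    (hA : ∀ i ∈ A, i ∈ K ∧ ℓ i = t ∧ (c.node i).isWide = true) :
    ∃ d : Circuit n m,
      d.size ≤ (K.filter fun i => (c.node i).isGate = true).card + A.card ∧ d.HasWidth w ∧
      ∀ x y, d.eval x y = true ↔ ∀ i ∈ A, c.evalAux x (c.mix P y' y) i = b i := by
  have hev := fun x y i (hi : i ∈ A) => evalAux_restrict (P := P) hK x y' y i fun _ => (hA i hi).1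
  let F : Fin c.N → (Fin n → Bool) → (Fin m → Bool) → Bool :=
    fun i x y => (c.restrict P (· ∈ K) y').evalAux x y i
  have hrel := c.isRelabeling_restrictNode P (· ∈ K) y'
  have hzero : ∀ r, t < r → (c.restrict P (· ∈ K) y').wideAt ℓ r = 0 := by
    intro r hr
    rw [wideAt, Finset.card_eq_zero, Finset.filter_eq_empty_iff]
    rintro i - ⟨hi, hwi⟩
    have := hKt i (mem_of_isWide_restrictNode (K := (· ∈ K)) hwi)
    omega
  have hprov : Provides w (K.filter fun i => (c.node i).isGate = true).card t 0
      {φ | ∃ i ∈ A, φ = F i} ∅ := by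
    refine ⟨c.restrict P (· ∈ K) y', ℓ, hrel.isLayering hℓ,
      fun r => (hrel.wideAt_le r).trans (hw r), fun r hr => hzero r (by omega),
      (hzero _ (Nat.lt_succ_self t)).le,
      size_restrict_le _ _ _ _, ?_, by simp⟩
    · rintro φ ⟨i, hi, rfl⟩
      exact ⟨i, (hA i hi).2.1, fun _ _ => rfl⟩
  have hcard : (A.filter fun i => b i = false).card + (A.filter fun i => b i = true).card =
      A.card := by
    rw [add_comm]
    simpa using Finset.card_filter_add_card_filter_not (s := A) (fun i => b i = true)
  have hAw : A.card ≤ w := (Finset.card_le_card fun i hi => by simp [hA i hi]).trans (hw t)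
  obtain ⟨d, hd, hs, hdw⟩ := Provides.conj_literals _
    ((A.filter fun i => b i = false).toList.map F) ((A.filter fun i => b i = true).toList.map F) t
    (hprov.mono le_rfl (by
      intro φ hφ
      simp only [Set.mem_ofPred_eq, List.mem_append, List.mem_map, Finset.mem_toList,
        Finset.mem_filter] at hφ
      rcases hφ with ⟨i, hi, rfl⟩ | ⟨i, hi, rfl⟩ <;> exact ⟨i, hi.1, rfl⟩) le_rfl)
    (by simpa [hcard] using hAw) hw0
  refine ⟨d, by simpa [hcard] using hs, hdw, fun x y => (hd x y).trans ?_⟩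
  constructor
  · rintro ⟨h1, h2⟩ i hi
    rw [← hev x y i hi]
    cases hb : b i with
    | false => exact h1 (F i) (List.mem_map_of_mem (by simp [hi, hb]))
    | true => exact h2 (F i) (List.mem_map_of_mem (by simp [hi, hb]))
  · intro h
    constructor
    · intro φ hφ
      obtain ⟨i, hi, rfl⟩ := List.mem_map.1 hφ
      obtain ⟨hi, hb⟩ : i ∈ A ∧ b i = false := by simpa using hi
      exact (hev x y i hi).trans ((h i hi).trans hb)
    · intro φ hφ
      obtain ⟨i, hi, rfl⟩ := List.mem_map.1 hφ
      obtain ⟨hi, hb⟩ : i ∈ A ∧ b i = true := by simpa using hi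
      exact (hev x y i hi).trans ((h i hi).trans hb)

end Circuit

namespace CNode

variable {n m : ℕ}

/-- Simplify a node whose predecessors `j` with `B j = some β` have the constant value `β`. -/
def absorb (B : ℕ → Option Bool) : CNode n m → CNode n m
  | gand j k =>
    match B j, B k with
    | some β, _ => if β = true then gcopy k else const false
    | none, some β => if β = true then gcopy j else const false
    | none, none => gand j k
  | gor j k =>
    match B j, B k with
    | some β, _ => if β = true then const true else gcopy k
    | none, some β => if β = true then const true else gcopy j
    | none, none => gor j k
  | gnot j =>
    match B j with
    | some β => const !β
    | none => gnot j
  | d => d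

theorem preds_absorb (B : ℕ → Option Bool) (d : CNode n m) : (d.absorb B).preds ⊆ d.preds := by
  cases d <;> simp only [absorb] <;> (try split) <;> (try split_ifs) <;> simp [preds]

theorem guess_of_absorb {B : ℕ → Option Bool} {d : CNode n m} {g : Fin m}
    (h : d.absorb B = guess g) : d = guess g := by
  cases d <;> simp only [absorb] at h <;> (try split at h) <;> (try split_ifs at h) <;> simp_all

theorem isGate_of_absorb {B : ℕ → Option Bool} {d : CNode n m} (h : (d.absorb B).isGate = true) :
    d.isGate = true ∧ ∀ j ∈ d.preds, B j = none := by
  cases d <;> simp only [absorb] at h <;> (try split at h) <;> (try split_ifs at h) <;>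
    simp_all [isGate, preds]

theorem val_absorb {B : ℕ → Option Bool} {v : ℕ → Bool} (d : CNode n m)
    (h : ∀ j ∈ d.preds, ∀ β, B j = some β → v j = β) (x : Fin n → Bool) (y : Fin m → Bool) :
    (d.absorb B).val x y v = d.val x y v := by
  cases d <;> simp only [absorb] <;> (try split) <;> (try split_ifs) <;> simp_all [val, preds]

end CNode

namespace Circuit

variable {n m : ℕ}

/-- A node all of whose predecessors are inputs. -/
def Fresh (c : Circuit n m) (i : Fin c.N) : Prop :=
  ∀ j ∈ (c.node i).preds, ∀ hj : j < c.N, ¬(c.node ⟨j, hj⟩).isWide = true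

/-- The known values of the wide nodes in layer `t`. -/
def layerValue (c : Circuit n m) (ℓ : Fin c.N → ℕ) (t : ℕ) (b : Fin c.N → Bool) (j : ℕ) :
    Option Bool :=
  if h : j < c.N then
    if ℓ ⟨j, h⟩ = t ∧ (c.node ⟨j, h⟩).isWide = true then some (b ⟨j, h⟩) else none
  else none

/-- Replace the wide nodes up to layer `t` by constants and simplify the next layer. -/
def upperNode (c : Circuit n m) (ℓ : Fin c.N → ℕ) (t : ℕ) (b : Fin c.N → Bool) (i : Fin c.N) :
    CNode n m :=
  if (c.node i).isWide = true ∧ ℓ i ≤ t then CNode.const (b i)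
  else (c.node i).absorb (c.layerValue ℓ t b)

theorem isRelabeling_upperNode (c : Circuit n m) (ℓ : Fin c.N → ℕ) (t : ℕ) (b : Fin c.N → Bool) :
    c.IsRelabeling (c.upperNode ℓ t b) where
  preds i := by
    unfold upperNode
    split_ifs
    · simp [CNode.preds]
    · exact CNode.preds_absorb _ _
  guess i g h := by
    unfold upperNode at h
    split_ifs at h
    exact CNode.guess_of_absorb h

/-- The part of a circuit above layer `t` when the wide nodes of that layer have values `b`. -/
abbrev upper (c : Circuit n m) (ℓ : Fin c.N → ℕ) (t : ℕ) (b : Fin c.N → Bool) : Circuit n m :=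
  c.relabel (c.upperNode ℓ t b) (c.isRelabeling_upperNode ℓ t b)

open Classical in
/-- The gates that remain above layer `t`. -/
noncomputable def upperGates (c : Circuit n m) (ℓ : Fin c.N → ℕ) (t : ℕ) : Finset (Fin c.N) :=
  Finset.univ.filter fun i => (c.node i).isGate = true ∧ t < ℓ i ∧ (ℓ i = t + 1 → c.Fresh i)

theorem mem_upperGates {c : Circuit n m} {ℓ : Fin c.N → ℕ} {t : ℕ} {i : Fin c.N} :
    i ∈ c.upperGates ℓ t ↔ (c.node i).isGate = true ∧ t < ℓ i ∧ (ℓ i = t + 1 → c.Fresh i) := by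
  simp [upperGates]

theorem size_upper_le {c : Circuit n m} {ℓ : Fin c.N → ℕ} (hℓ : c.IsLayering ℓ) (t : ℕ)
    (b : Fin c.N → Bool) : (c.upper ℓ t b).size ≤ (c.upperGates ℓ t).card := by
  refine Finset.card_le_card fun i hi => ?_
  have hi : (c.upperNode ℓ t b i).isGate = true := (Finset.mem_filter.1 hi).2
  unfold upperNode at hi
  split_ifs at hi with h
  · simp [CNode.isGate] at hi
  · obtain ⟨hg, hp⟩ := CNode.isGate_of_absorb hi
    have hw := CNode.isWide_of_isGate hg
    refine mem_upperGates.2 ⟨hg, not_le.1 fun hle => h ⟨hw, hle⟩, fun ht j hj hjN hwj => ?_⟩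
    have hB := hp j hj
    have hlj := hℓ i j hj hjN
    unfold layerValue at hB
    rw [dif_pos hjN, if_pos ⟨by omega, hwj⟩] at hB
    simp at hB

theorem evalAux_upper {c : Circuit n m} {ℓ : Fin c.N → ℕ} (hℓ : c.IsLayering ℓ) {t : ℕ}
    {b : Fin c.N → Bool} {x : Fin n → Bool} {y y' : Fin m → Bool}
    (hb : ∀ i, ℓ i = t → (c.node i).isWide = true → c.evalAux x y i = b i)
    (hy : ∀ i g, t ≤ ℓ i → c.node i = CNode.guess g → y' g = y g) (i : Fin c.N) (hi : t ≤ ℓ i) :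
    (c.upper ℓ t b).evalAux x y' i = c.evalAux x y i := by
  refine evalAux_eq_of_local (c.upper ℓ t b) x y' (fun i => t ≤ ℓ i) (c.evalAux x y)
    (fun i hi => ?_) i hi
  change (∀ j ∈ (c.upperNode ℓ t b i).preds, ∀ hj : j < c.N, t ≤ ℓ ⟨j, hj⟩) ∧
    (c.upperNode ℓ t b i).val x y' _ = _
  unfold upperNode
  split_ifs with h
  · exact ⟨by simp [CNode.preds], (hb i (le_antisymm h.2 hi) h.1).symm⟩
  · refine ⟨fun j hj hjN => ?_, ?_⟩
    · have hj := CNode.preds_absorb _ _ hj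
      have := hℓ i j hj hjN
      have : ¬ℓ i ≤ t := fun hle => h ⟨CNode.isWide_of_mem_preds hj, hle⟩
      omega
    · rw [CNode.val_absorb, evalAux_eq c x y i i.2]
      · cases hd : c.node i with
        | guess g => exact hy i g hi hd
        | _ => rfl
      · intro j hj β hβ
        unfold layerValue at hβ
        split_ifs at hβ with hjN hw
        exact (hb _ hw.1 hw.2).trans (Option.some.inj hβ)

/-- As a function of the guesses one layer below, a wide node is a layer gate. -/
theorem exists_layerGate {c : Circuit n m} {ℓ : Fin c.N → ℕ} (hℓ : c.IsLayering ℓ) {t : ℕ}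
    (i : Fin c.N) (hi : ℓ i = t) (hw : (c.node i).isWide = true) :
    ∃ g : LayerGate ((Fin n → Bool) × (Fin m → Bool)) (Fin m), ∀ x y y',
      g.eval (x, y) y' = c.evalAux x (c.mix (fun i => ℓ i + 1 = t) y' y) i := by
  subst hi
  have pred : ∀ j ∈ (c.node i).preds,
      (∃ v, ∀ x y y', c.evalAux x (c.mix (fun k => ℓ k + 1 = ℓ i) y' y) j = y' v) ∨
      ∀ x y y', c.evalAux x (c.mix (fun k => ℓ k + 1 = ℓ i) y' y) j = c.evalAux x y j := by
    intro j hj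
    have hjN := (c.wf i j hj).trans i.2
    have hlj := hℓ i j hj hjN
    by_cases hg : ∃ v, c.node ⟨j, hjN⟩ = CNode.guess v
    · obtain ⟨v, hv⟩ := hg
      refine Or.inl ⟨v, fun x y y' => ?_⟩
      rw [evalAux_eq c _ _ j hjN, hv]
      exact mix_of_mem hv hlj
    · refine Or.inr fun x y y' => evalAux_congr_guess c x
        (fun k => ℓ k + 1 < ℓ i ∨ k = ⟨j, hjN⟩) ?_ ?_ ⟨j, hjN⟩ (Or.inr rfl)
      · intro k hk r hr hrN
        have := hℓ k r hr hrN
        rcases hk with hk | rfl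
        · exact Or.inl (by omega)
        · exact Or.inl (by omega)
      · rintro k g (hk | rfl) hkg
        · exact mix_of_notMem hkg hk.ne
        · exact (hg ⟨g, hkg⟩).elim
  have he := fun x y => evalAux_eq c x y i i.2
  simp only [he]
  cases hd : c.node i with
  | gand j k =>
    simp only [hd, CNode.preds, List.mem_cons, List.not_mem_nil, or_false, forall_eq_or_imp,
      forall_eq] at pred
    obtain ⟨⟨v, hv⟩ | hj, ⟨v', hv'⟩ | hk⟩ := pred
    · refine ⟨.two v v' false false false, fun x y y' => ?_⟩
      simp only [CNode.val, hv, hv', LayerGate.eval]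
      cases y' v <;> cases y' v' <;> rfl
    · refine ⟨.one v false false fun z => c.evalAux z.1 z.2 k, fun x y y' => ?_⟩
      simp only [CNode.val, hv, hk, LayerGate.eval]
      cases y' v <;> simp
    · refine ⟨.one v' false false fun z => c.evalAux z.1 z.2 j, fun x y y' => ?_⟩
      simp only [CNode.val, hv', hj, LayerGate.eval]
      cases y' v' <;> simp
    · exact ⟨.fixed fun z => c.evalAux z.1 z.2 j && c.evalAux z.1 z.2 k, fun x y y' => by
        simp only [CNode.val, hj, hk, LayerGate.eval]⟩
  | gor j k =>
    simp only [hd, CNode.preds, List.mem_cons, List.not_mem_nil, or_false, forall_eq_or_imp,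
      forall_eq] at pred
    obtain ⟨⟨v, hv⟩ | hj, ⟨v', hv'⟩ | hk⟩ := pred
    · refine ⟨.two v v' true true true, fun x y y' => ?_⟩
      simp only [CNode.val, hv, hv', LayerGate.eval]
      cases y' v <;> cases y' v' <;> rfl
    · refine ⟨.one v true true fun z => c.evalAux z.1 z.2 k, fun x y y' => ?_⟩
      simp only [CNode.val, hv, hk, LayerGate.eval]
      cases y' v <;> simp
    · refine ⟨.one v' true true fun z => c.evalAux z.1 z.2 j, fun x y y' => ?_⟩
      simp only [CNode.val, hv', hj, LayerGate.eval]
      cases y' v' <;> simp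
    · exact ⟨.fixed fun z => c.evalAux z.1 z.2 j || c.evalAux z.1 z.2 k, fun x y y' => by
        simp only [CNode.val, hj, hk, LayerGate.eval]⟩
  | gnot j =>
    simp only [hd, CNode.preds, List.mem_cons, List.not_mem_nil, or_false, forall_eq] at pred
    obtain ⟨v, hv⟩ | hj := pred
    · refine ⟨.one v false true fun _ => false, fun x y y' => ?_⟩
      simp only [CNode.val, hv, LayerGate.eval]
      cases y' v <;> rfl
    · exact ⟨.fixed fun z => !c.evalAux z.1 z.2 j, fun x y y' => by
        simp only [CNode.val, hj, LayerGate.eval]⟩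
  | gcopy j =>
    simp only [hd, CNode.preds, List.mem_cons, List.not_mem_nil, or_false, forall_eq] at pred
    obtain ⟨v, hv⟩ | hj := pred
    · refine ⟨.one v false false fun _ => true, fun x y y' => ?_⟩
      simp only [CNode.val, hv, LayerGate.eval]
      cases y' v <;> rfl
    · exact ⟨.fixed fun z => c.evalAux z.1 z.2 j, fun x y y' => by
        simp only [CNode.val, hj, LayerGate.eval]⟩
  | _ => simp [hd, CNode.isWide] at hw

instance : Inhabited (Circuit n m) :=
  ⟨⟨1, fun _ => CNode.const false, 0, by simp [CNode.preds], by simp⟩⟩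

theorem _root_.Finset.exists_chunks {α : Type*} [DecidableEq α] (k : ℕ) :
    ∀ (j : ℕ) (F : Finset α), F.card ≤ j * k →
      ∃ L : List (Finset α), L.length = j ∧ (∀ G ∈ L, G ⊆ F ∧ G.card ≤ k) ∧ ∀ a ∈ F, ∃ G ∈ L, a ∈ G
  | 0, F, h => ⟨[], by simp_all⟩
  | j + 1, F, h => by
    obtain ⟨G, hG, hc⟩ := Finset.exists_subset_card_eq (Nat.min_le_right k F.card)
    have hd : (F \ G).card ≤ j * k := by
      rw [Finset.card_sdiff_of_subset hG, hc]
      rw [add_mul] at h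
      omega
    obtain ⟨L, hL, hLF, hcov⟩ := Finset.exists_chunks k j (F \ G) hd
    refine ⟨G :: L, by simp [hL], ?_, fun a ha => ?_⟩
    · simp only [List.mem_cons, forall_eq_or_imp]
      exact ⟨⟨hG, hc.le.trans (Nat.min_le_left _ _)⟩, fun G' hG' =>
        ⟨(hLF G' hG').1.trans Finset.sdiff_subset, (hLF G' hG').2⟩⟩
    · by_cases haG : a ∈ G
      · exact ⟨G, by simp, haG⟩
      · obtain ⟨G', hG', haG'⟩ := hcov a (by simp [ha, haG])
        exact ⟨G', by simp [hG'], haG'⟩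

open Classical in
/-- The wide nodes of layer `t` that are not fresh. -/
noncomputable def frontier (c : Circuit n m) (ℓ : Fin c.N → ℕ) (t : ℕ) : Finset (Fin c.N) :=
  Finset.univ.filter fun i => (c.node i).isWide = true ∧ ℓ i = t ∧ ¬c.Fresh i

theorem mem_frontier {c : Circuit n m} {ℓ : Fin c.N → ℕ} {t : ℕ} {i : Fin c.N} :
    i ∈ c.frontier ℓ t ↔ (c.node i).isWide = true ∧ ℓ i = t ∧ ¬c.Fresh i := by
  simp [frontier]

open Classical in
/-- The frontier of layer `t` together with the wide nodes below layer `t`. -/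
noncomputable def lowerNodes (c : Circuit n m) (ℓ : Fin c.N → ℕ) (t : ℕ) : Finset (Fin c.N) :=
  Finset.univ.filter fun i => (c.node i).isWide = true ∧ (ℓ i < t ∨ ℓ i = t ∧ ¬c.Fresh i)

theorem mem_lowerNodes {c : Circuit n m} {ℓ : Fin c.N → ℕ} {t : ℕ} {i : Fin c.N} :
    i ∈ c.lowerNodes ℓ t ↔ (c.node i).isWide = true ∧ (ℓ i < t ∨ ℓ i = t ∧ ¬c.Fresh i) := by
  simp [lowerNodes]

theorem mem_lowerNodes_of_mem_preds {c : Circuit n m} {ℓ : Fin c.N → ℕ} (hℓ : c.IsLayering ℓ)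
    {t : ℕ} : ∀ i ∈ c.lowerNodes ℓ t, ∀ j ∈ (c.node i).preds, ∀ hj : j < c.N,
      (c.node ⟨j, hj⟩).isWide = true → ⟨j, hj⟩ ∈ c.lowerNodes ℓ t := by
  intro i hi j hj hjN hwj
  have := hℓ i j hj hjN
  obtain ⟨-, hi⟩ := mem_lowerNodes.1 hi
  exact mem_lowerNodes.2 ⟨hwj, Or.inl (by omega)⟩

/-- The cost of checking the frontier of layer `t`. -/
noncomputable def lowerSize (c : Circuit n m) (ℓ : Fin c.N → ℕ) (t : ℕ) : ℕ :=
  ((c.lowerNodes ℓ t).filter fun i => (c.node i).isGate = true).card + (c.frontier ℓ t).card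

theorem lowerSize_zero {c : Circuit n m} {ℓ : Fin c.N → ℕ} (hℓ : c.IsLayering ℓ) :
    c.lowerSize ℓ 0 = 0 := by
  have h1 : c.lowerNodes ℓ 0 = ∅ := by
    refine Finset.eq_empty_of_forall_notMem fun i hi => ?_
    obtain ⟨hw, hi⟩ := mem_lowerNodes.1 hi
    have := pos_layer_of_isWide hℓ hw
    omega
  have h2 : c.frontier ℓ 0 = ∅ := by
    refine Finset.eq_empty_of_forall_notMem fun i hi => ?_
    obtain ⟨hw, hi, -⟩ := mem_frontier.1 hi
    have := pos_layer_of_isWide hℓ hw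
    omega
  simp [lowerSize, h1, h2]

theorem lowerSize_add_card_upperGates_le (c : Circuit n m) (ℓ : Fin c.N → ℕ) (t : ℕ) :
    c.lowerSize ℓ (t + 1) + (c.upperGates ℓ t).card ≤ c.size + c.wideAt ℓ (t + 1) := by
  have h1 : (c.frontier ℓ (t + 1)).card ≤ c.wideAt ℓ (t + 1) := by
    refine Finset.card_le_card fun i hi => ?_
    obtain ⟨hw, hi, -⟩ := mem_frontier.1 hi
    simp [hw, hi]
  have hd : Disjoint ((c.lowerNodes ℓ (t + 1)).filter fun i => (c.node i).isGate = true)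
      (c.upperGates ℓ t) := by
    refine Finset.disjoint_left.2 fun i hi hi' => ?_
    obtain ⟨-, hl, hf⟩ := mem_upperGates.1 hi'
    rcases (mem_lowerNodes.1 (Finset.mem_filter.1 hi).1).2 with h | ⟨h, hn⟩
    · omega
    · exact hn (hf h)
  have h2 := Finset.card_union_of_disjoint hd
  have h3 : (((c.lowerNodes ℓ (t + 1)).filter fun i => (c.node i).isGate = true) ∪
      c.upperGates ℓ t).card ≤ c.size := by
    refine Finset.card_le_card fun i hi => ?_
    rcases Finset.mem_union.1 hi with hi | hi
    · exact Finset.mem_filter.2 ⟨Finset.mem_univ _, (Finset.mem_filter.1 hi).2⟩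
    · exact Finset.mem_filter.2 ⟨Finset.mem_univ _, (mem_upperGates.1 hi).1⟩
  unfold lowerSize
  omega

/-- Given the values `b` of the wide nodes of layer `t` and the guesses `y'` of layer `t - 1`, the
circuit splits into at most six small circuits with independent guesses. -/
theorem exists_split {c : Circuit n m} {ℓ : Fin c.N → ℕ} {w B t : ℕ} (hℓ : c.IsLayering ℓ)
    (hw : ∀ t, c.wideAt ℓ t ≤ w) (hw0 : 0 < w) (ht : t ≤ ℓ c.output) (hlow : c.lowerSize ℓ t ≤ B)
    (hhigh : (c.upperGates ℓ t).card ≤ B) (hB : 2 * ((w + 3) / 4) ≤ B) (b : Fin c.N → Bool)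
    (y' : Fin m → Bool) :
    ∃ Cs : List (Circuit n m), Cs.length ≤ 6 ∧ (∀ d ∈ Cs, d.size ≤ B ∧ d.HasWidth w) ∧
      (∀ x y, c.eval x y = true →
        (∀ i, ℓ i = t → (c.node i).isWide = true → c.evalAux x y i = b i) →
        (∀ i, ℓ i = t → (c.node i).isWide = true →
          c.evalAux x (c.mix (fun i => ℓ i + 1 = t) y' y) i = b i) →
        ∀ d ∈ Cs, d.eval x y = true) ∧
      ∀ x, (∀ d ∈ Cs, ∃ y, d.eval x y = true) → ∃ y, c.eval x y = true := by
  classical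
  let P : Fin c.N → Prop := fun i => ℓ i + 1 = t
  obtain ⟨dl, hdl, hdlw, hdle⟩ := exists_check hℓ hw hw0 P y' b (t := t) (K := c.lowerNodes ℓ t)
    (A := c.frontier ℓ t) (fun i hi => by have := (mem_lowerNodes.1 hi).2; omega)
    (mem_lowerNodes_of_mem_preds hℓ) (fun i hi => by
      obtain ⟨h1, h2, h3⟩ := mem_frontier.1 hi
      exact ⟨mem_lowerNodes.2 ⟨h1, Or.inr ⟨h2, h3⟩⟩, h2, h1⟩)
  let F : Finset (Fin c.N) := Finset.univ.filter fun i =>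
    (ℓ i = t ∧ (c.node i).isWide = true) ∧ c.Fresh i
  have hF : F.card ≤ 4 * ((w + 3) / 4) := by
    have : F.card ≤ w :=
      (Finset.card_le_card (Finset.monotone_filter_right _ fun i _ h => h.1)).trans (hw t)
    omega
  obtain ⟨L, hL, hLF, hcov⟩ := Finset.exists_chunks _ 4 F hF
  have hfresh : ∀ G ∈ L, ∃ d : Circuit n m, (d.size ≤ B ∧ d.HasWidth w) ∧
      ∀ x y, d.eval x y = true ↔ ∀ i ∈ G, c.evalAux x (c.mix P y' y) i = b i := by
    intro G hG
    obtain ⟨hGF, hGc⟩ := hLF G hG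
    have hG' : ∀ i ∈ G, (ℓ i = t ∧ (c.node i).isWide = true) ∧ c.Fresh i := fun i hi =>
      (Finset.mem_filter.1 (hGF hi)).2
    obtain ⟨d, hd, hdw, hde⟩ := exists_check hℓ hw hw0 P y' b (t := t) (K := G) (A := G)
      (fun i hi => (hG' i hi).1.1.le) (fun i hi j hj hjN hwj => ((hG' i hi).2 j hj hjN hwj).elim)
      (fun i hi => ⟨hi, (hG' i hi).1⟩)
    have := Finset.card_filter_le G fun i => (c.node i).isGate = true
    exact ⟨d, ⟨by omega, hdw⟩, hde⟩
  choose! D hD hDe using hfresh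
  have hrel := c.isRelabeling_upperNode ℓ t b
  refine ⟨dl :: c.upper ℓ t b :: L.map D, by simp [hL], ?_, ?_, ?_⟩
  · simp only [List.mem_cons, List.mem_map, forall_eq_or_imp, forall_exists_index, and_imp,
      forall_apply_eq_imp_iff₂]
    exact ⟨⟨hdl.trans hlow, hdlw⟩, ⟨(size_upper_le hℓ t b).trans hhigh, hrel.hasWidth hℓ hw⟩, hD⟩
  · intro x y hxy hb hb'
    simp only [List.mem_cons, List.mem_map, forall_eq_or_imp, forall_exists_index, and_imp,
      forall_apply_eq_imp_iff₂]
    refine ⟨(hdle x y).2 fun i hi => ?_, ?_, fun G hG => (hDe G hG x y).2 fun i hi => ?_⟩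
    · obtain ⟨h1, h2, -⟩ := mem_frontier.1 hi
      exact hb' i h2 h1
    · exact (evalAux_upper hℓ hb (fun _ _ _ _ => rfl) c.output ht).trans hxy
    · obtain ⟨h1, -⟩ := (Finset.mem_filter.1 ((hLF G hG).1 hi)).2
      exact hb' i h1.1 h1.2
  · intro x h
    simp only [List.mem_cons, List.mem_map, forall_eq_or_imp, forall_exists_index, and_imp,
      forall_apply_eq_imp_iff₂] at h
    obtain ⟨⟨yl, hyl⟩, ⟨yh, hyh⟩, hG⟩ := h
    let y := c.mix (fun i => t ≤ ℓ i) yh (c.mix P y' yl)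
    refine ⟨y, ?_⟩
    have hlow' : ∀ {i g} (z : Fin m → Bool), c.node i = CNode.guess g → ℓ i + 1 = t →
        y g = c.mix P y' z g := by
      intro i g z hg hi
      rw [mix_of_mem hg hi]
      exact (mix_of_notMem hg (by omega)).trans (mix_of_mem hg hi)
    have hval : ∀ (i : Fin c.N) (z : Fin m → Bool), (c.node i).isWide = true →
        (∀ j ∈ (c.node i).preds, c.evalAux x y j = c.evalAux x z j) →
        c.evalAux x y i = c.evalAux x z i := by
      intro i z hwi hj
      rw [evalAux_eq c x y i i.2, evalAux_eq c x z i i.2, CNode.val_congr_guess _ hwi]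
      exact CNode.val_congr _ hj
    have hb : ∀ i, ℓ i = t → (c.node i).isWide = true → c.evalAux x y i = b i := by
      intro i hi hwi
      by_cases hf : c.Fresh i
      · obtain ⟨G, hGL, hiG⟩ := hcov i (by simp [F, hi, hwi, hf])
        obtain ⟨z, hz⟩ := hG G hGL
        rw [← (hDe G hGL x z).1 hz i hiG]
        refine hval i _ hwi fun j hj => ?_
        have hjN := (c.wf i j hj).trans i.2
        have hlj := hℓ i j hj hjN
        refine evalAux_congr_guess c x (fun k => ℓ k + 1 = t ∧ ¬(c.node k).isWide = true) ?_ ?_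
          ⟨j, hjN⟩ ⟨by omega, hf j hj hjN⟩
        · intro k hk r hr
          exact (hk.2 (CNode.isWide_of_mem_preds hr)).elim
        · intro k g hk hg
          exact hlow' z hg hk.1
      · rw [← (hdle x yl).1 hyl i (mem_frontier.2 ⟨hwi, hi, hf⟩)]
        refine hval i _ hwi fun j hj => ?_
        have hjN := (c.wf i j hj).trans i.2
        have hlj := hℓ i j hj hjN
        refine evalAux_congr_guess c x (fun k => ℓ k < t) ?_ ?_ ⟨j, hjN⟩ (by omega)
        · intro k hk r hr hrN
          have := hℓ k r hr hrN
          omega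
        · intro k g hk hg
          exact mix_of_notMem hg (by omega)
    exact (evalAux_upper (y' := yh) hℓ hb (fun i g hi hg => (mix_of_mem hg hi).symm) c.output
      ht).symm.trans hyh

/-- Recombine the deterministic versions of the circuits obtained by cutting at layer `t`. -/
theorem exists_det_of_cut {c : Circuit n m} {ℓ : Fin c.N → ℕ} {w B t s' w' : ℕ}
    (H : ∀ d : Circuit n m, d.size ≤ B → d.HasWidth w → ∃ D : Circuit n 0,
      (∀ x y, D.eval x y = true ↔ ∃ y', d.eval x y' = true) ∧ D.size ≤ s' ∧ D.HasWidth w')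
    (hℓ : c.IsLayering ℓ) (hw : ∀ t, c.wideAt ℓ t ≤ w) (hw0 : 0 < w) (ht : t ≤ ℓ c.output)
    (hlow : c.lowerSize ℓ t ≤ B) (hhigh : (c.upperGates ℓ t).card ≤ B)
    (hB : 2 * ((w + 3) / 4) ≤ B) :
    ∃ D : Circuit n 0, (∀ x y, D.eval x y = true ↔ ∃ y', c.eval x y' = true) ∧
      D.size ≤ 2 ^ w * (6 * (s' + 1) + 1) ∧ D.HasWidth (w' + 2) := by
  classical
  choose! F hF hFs using H
  let ι := {i : Fin c.N // ℓ i = t ∧ (c.node i).isWide = true}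
  choose gs hgs using fun i : ι => exists_layerGate hℓ i.1 i.2.1 i.2.2
  obtain ⟨O, hOc, hO⟩ := LayerGate.exists_cover gs
  have hι : Fintype.card ι ≤ w := by
    rw [Fintype.card_subtype]
    exact hw t
  choose Cs hlen hCs hfw hbw using fun o : (ι → Bool) × (Fin m → Bool) =>
    exists_split hℓ hw hw0 ht hlow hhigh hB
      (fun i => if h : ℓ i = t ∧ (c.node i).isWide = true then o.1 ⟨i, h⟩ else false) o.2
  obtain ⟨E, hE, hEs, hEw⟩ := exists_or_and (W := w') (s := s') (r := 6)
    (O.toList.map fun o => (Cs o).map F) (by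
      intro Ds hDs
      obtain ⟨o, -, rfl⟩ := List.mem_map.1 hDs
      refine ⟨by simpa using hlen o, fun D hD => ?_⟩
      obtain ⟨d, hd, rfl⟩ := List.mem_map.1 hD
      exact hFs d (hCs o d hd).1 (hCs o d hd).2)
  refine ⟨E, fun x y => (hE x y).trans ?_, hEs.trans ?_, hEw⟩
  · simp only [List.mem_map, Finset.mem_toList, exists_exists_and_eq_and, forall_exists_index,
      and_imp, forall_apply_eq_imp_iff₂]
    have hiff : ∀ o, ∀ d ∈ Cs o, ((F d).eval x y = true ↔ ∃ y', d.eval x y' = true) :=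
      fun o d hd => hF d (hCs o d hd).1 (hCs o d hd).2 x y
    constructor
    · rintro ⟨o, -, ho⟩
      exact hbw o x fun d hd => (hiff o d hd).1 (ho d hd)
    · rintro ⟨y₁, hy₁⟩
      obtain ⟨o, ho, hog⟩ := hO (x, y₁) y₁
      simp only [hgs, mix_self] at hog
      refine ⟨o, ho, fun d hd => (hiff o d hd).2 ⟨y₁, hfw o x y₁ hy₁ ?_ ?_ d hd⟩⟩
      · intro i hi hwi
        rw [dif_pos ⟨hi, hwi⟩]
        exact (hog ⟨i, hi, hwi⟩).1
      · intro i hi hwi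
        rw [dif_pos ⟨hi, hwi⟩]
        exact (hog ⟨i, hi, hwi⟩).2
  · rw [List.length_map, Finset.length_toList]
    exact Nat.mul_le_mul_right _ (hOc.trans (Nat.pow_le_pow_right two_pos hι))

/-- Nodes that the output does not depend on can be dropped. -/
theorem exists_of_lowerSet {c : Circuit n m} {ℓ : Fin c.N → ℕ} {w : ℕ} (hℓ : c.IsLayering ℓ)
    (hw : ∀ t, c.wideAt ℓ t ≤ w) (K : Finset (Fin c.N))
    (hK : ∀ i ∈ K, ∀ j ∈ (c.node i).preds, ∀ hj : j < c.N,
      (c.node ⟨j, hj⟩).isWide = true → ⟨j, hj⟩ ∈ K)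
    (hout : (c.node c.output).isWide = true → c.output ∈ K) :
    ∃ d : Circuit n m, d.size ≤ (K.filter fun i => (c.node i).isGate = true).card ∧
      d.HasWidth w ∧ ∀ x y, d.eval x y = c.eval x y := by
  refine ⟨c.restrict (fun _ => False) (· ∈ K) fun _ => false, size_restrict_le _ _ _ _,
    (c.isRelabeling_restrictNode _ _ _).hasWidth hℓ hw, fun x y => ?_⟩
  exact (evalAux_restrict hK x _ y c.output hout).trans (by rw [mix_false]; rfl)

/-- A circuit without gates computes a monotone function. -/
theorem evalAux_mono_of_size_eq_zero {c : Circuit n m} (hc : c.size = 0) {x x' : Fin n → Bool}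
    (hx : x ≤ x') (y : Fin m → Bool) (i : ℕ) (hi : i < c.N) :
    c.evalAux x y i ≤ c.evalAux x' y i := by
  induction i using Nat.strong_induction_on with
  | _ i ih =>
    have hg : ¬(c.node ⟨i, hi⟩).isGate = true := fun h =>
      Finset.eq_empty_iff_forall_notMem.1 (Finset.card_eq_zero.1 hc) ⟨i, hi⟩ (by simpa using h)
    have hwf := c.wf ⟨i, hi⟩
    rw [evalAux_eq c x y i hi, evalAux_eq c x' y i hi]
    cases hd : c.node ⟨i, hi⟩ with
    | actual a => exact hx a
    | gcopy j =>
      have hj : j < i := hwf j (by simp [hd, CNode.preds])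
      exact ih j hj (hj.trans hi)
    | guess | const => exact le_rfl
    | _ => simp [hd, CNode.isGate] at hg

theorem size_pos_of_computes_not {c : Circuit 1 m} (hc : c.Computes fun x => !x 0) :
    0 < c.size := by
  by_contra h
  obtain ⟨y, hy⟩ := (hc fun _ => false).1 rfl
  have hle := evalAux_mono_of_size_eq_zero (Nat.eq_zero_of_not_pos h)
    (x := fun _ => false) (x' := fun _ => true) (fun _ => Bool.false_le _) y c.output c.output.2
  have := (hc fun _ => true).2 ⟨y, hle hy⟩
  simp at this

theorem exists_not_circuit :
    ∃ c : Circuit 1 0, c.size ≤ 1 ∧ c.HasWidth 1 ∧ c.Computes fun x => !x 0 := by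
  refine ⟨⟨2, ![.actual 0, .gnot 0], 1, by simp [Fin.forall_fin_two, CNode.preds], by simp⟩,
    by decide, ⟨fun i => i, ?_, ?_⟩, ?_⟩
  · simp [IsLayering, Fin.forall_fin_two, CNode.preds]
  · intro t
    refine Finset.card_le_one.2 fun i hi j hj => Fin.ext ?_
    exact (Finset.mem_filter.1 hi).2.1.trans (Finset.mem_filter.1 hj).2.1.symm
  · intro x
    simp [eval, evalAux, nodeAt]

theorem HasWidth.mono {c : Circuit n m} {w w' : ℕ} (h : c.HasWidth w) (hw : w ≤ w') :
    c.HasWidth w' := by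
  obtain ⟨ℓ, hℓ, h⟩ := h
  exact ⟨ℓ, hℓ, fun t => (h t).trans hw⟩

theorem exists_det_of_size_le {c : Circuit n m} {s w s' w' : ℕ}
    (H : ∀ d : Circuit n m, d.size ≤ s + (w + 1) / 2 → d.HasWidth w → ∃ D : Circuit n 0,
      (∀ x y, D.eval x y = true ↔ ∃ y', d.eval x y' = true) ∧ D.size ≤ s' ∧ D.HasWidth w')
    (hs' : 0 < s → 0 < w → 0 < s') (hc : c.size ≤ 2 * s) (hcw : c.HasWidth w) :
    ∃ D : Circuit n 0, (∀ x y, D.eval x y = true ↔ ∃ y', c.eval x y' = true) ∧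
      D.size ≤ 13 * 2 ^ w * s' ∧ D.HasWidth (w' + 2) := by
  obtain ⟨ℓ, hℓ, hw : ∀ t, c.wideAt ℓ t ≤ w⟩ := hcw
  have hpow : 1 ≤ 13 * 2 ^ w := Nat.mul_pos (by norm_num) (Nat.two_pow_pos w)
  have hsmall : ∀ K : Finset (Fin c.N),
      (∀ i ∈ K, ∀ j ∈ (c.node i).preds, ∀ hj : j < c.N,
        (c.node ⟨j, hj⟩).isWide = true → ⟨j, hj⟩ ∈ K) →
      ((c.node c.output).isWide = true → c.output ∈ K) →
      (K.filter fun i => (c.node i).isGate = true).card ≤ s + (w + 1) / 2 →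
      ∃ D : Circuit n 0, (∀ x y, D.eval x y = true ↔ ∃ y', c.eval x y' = true) ∧
        D.size ≤ 13 * 2 ^ w * s' ∧ D.HasWidth (w' + 2) := by
    intro K hK hout hKc
    obtain ⟨d, hd, hdw, hde⟩ := exists_of_lowerSet hℓ hw K hK hout
    obtain ⟨D, hD, hDs, hDw⟩ := H d (hd.trans hKc) hdw
    simp only [hde] at hD
    exact ⟨D, hD, hDs.trans (Nat.le_mul_of_pos_left _ hpow), hDw.mono (Nat.le_add_right _ _)⟩
  by_cases hout : (c.node c.output).isWide = true
  swap
  · exact hsmall ∅ (by simp) (fun h => (hout h).elim) (by simp)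
  have hw0 : 0 < w := (Finset.card_pos.2 ⟨c.output, by simp [hout]⟩).trans_le (hw (ℓ c.output))
  rcases Nat.eq_zero_or_pos s with rfl | hs
  · refine hsmall Finset.univ (by simp) (by simp) ?_
    exact hc.trans (Nat.zero_le _)
  by_cases hfresh : c.Fresh c.output
  · refine hsmall {c.output} ?_ (by simp) ((Finset.card_filter_le _ _).trans ?_)
    · rintro i hi j hj hjN hwj
      rw [Finset.mem_singleton.1 hi] at hj
      exact (hfresh j hj hjN hwj).elim
    · rw [Finset.card_singleton]
      omega
  by_cases hlow : c.lowerSize ℓ (ℓ c.output) ≤ s + (w + 1) / 2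
  · exact hsmall (c.lowerNodes ℓ (ℓ c.output)) (mem_lowerNodes_of_mem_preds hℓ)
      (fun h => mem_lowerNodes.2 ⟨h, Or.inr ⟨rfl, hfresh⟩⟩) ((Nat.le_add_right _ _).trans hlow)
  classical
  have hex : ∃ t, ¬c.lowerSize ℓ t ≤ s + (w + 1) / 2 := ⟨_, hlow⟩
  obtain ⟨t, ht⟩ : ∃ t, Nat.find hex = t + 1 := by
    refine Nat.exists_eq_succ_of_ne_zero fun h => ?_
    have := Nat.find_spec hex
    rw [h, lowerSize_zero hℓ] at this
    omega
  have hle := Nat.find_min' hex hlow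
  have hgt := Nat.find_spec hex
  have hlt := not_not.1 (Nat.find_min hex (m := t) (by omega))
  rw [ht] at hle hgt
  have hsum := c.lowerSize_add_card_upperGates_le ℓ t
  have hwt := hw (t + 1)
  obtain ⟨D, hD, hDs, hDw⟩ := exists_det_of_cut H hℓ hw hw0 (t := t) (by omega) hlt (by omega)
    (by omega)
  refine ⟨D, hD, hDs.trans ?_, hDw⟩
  rw [mul_comm 13, mul_assoc]
  have := hs' hs hw0
  exact Nat.mul_le_mul_left _ (by omega)

end Circuit

/-- There is an absolute constant `c > 0` such that for all
`s, w, s', w'`: if every nondeterministic circuit of size at most `s + ⌈w/2⌉`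
and width at most `w` can be converted to a deterministic circuit of size at
most `s'` and width at most `w'` computing the same Boolean function, then
every nondeterministic circuit of size at most `2s` and width at most `w` can
be converted to a deterministic circuit of size at most `c·2^w·s'` and width at
most `w' + 2` computing the same Boolean function. -/
theorem ndc_to_dc_recursion_step :
    ∃ c : ℕ, 0 < c ∧
      ∀ s w s' w' : ℕ,
        (∀ (n m : ℕ) (C : Circuit n m) (f : (Fin n → Bool) → Bool),
            C.size ≤ s + (w + 1) / 2 → C.HasWidth w → C.Computes f →
            ∃ D : Circuit n 0, D.Computes f ∧ D.size ≤ s' ∧ D.HasWidth w') →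
        (∀ (n m : ℕ) (C : Circuit n m) (f : (Fin n → Bool) → Bool),
            C.size ≤ 2 * s → C.HasWidth w → C.Computes f →
            ∃ D : Circuit n 0, D.Computes f ∧ D.size ≤ c * 2 ^ w * s' ∧
              D.HasWidth (w' + 2)) := by
  refine ⟨13, by norm_num, fun s w s' w' H n m C f hCs hCw hCf => ?_⟩
  have hdet : ∀ d : Circuit n m, d.size ≤ s + (w + 1) / 2 → d.HasWidth w → ∃ D : Circuit n 0,
      (∀ x y, D.eval x y = true ↔ ∃ y', d.eval x y' = true) ∧ D.size ≤ s' ∧ D.HasWidth w' := by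
    intro d hds hdw
    classical
    obtain ⟨D, hD, hDs, hDw⟩ := H n m d (fun x => decide (∃ y, d.eval x y = true)) hds hdw
      fun x => decide_eq_true_iff
    refine ⟨D, fun x y => ?_, hDs, hDw⟩
    rw [← decide_eq_true_iff (p := ∃ y', d.eval x y' = true), hD x]
    exact ⟨fun h => ⟨y, h⟩, fun ⟨y', h⟩ => Subsingleton.elim y' y ▸ h⟩
  have hs' : 0 < s → 0 < w → 0 < s' := by
    intro hs hw
    obtain ⟨d, hds, hdw, hd⟩ := Circuit.exists_not_circuit
    obtain ⟨D, hD, hDs, -⟩ := H 1 0 d _ (by omega) (hdw.mono hw) hd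
    exact (Circuit.size_pos_of_computes_not hD).trans_le hDs
  obtain ⟨D, hD, hDs, hDw⟩ := Circuit.exists_det_of_size_le hdet hs' hCs hCw
  refine ⟨D, fun x => ?_, hDs, hDw⟩
  simp only [hD, exists_const]
  exact hCf x
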